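/- arXiv:1912.12648 — 10 statements merged into one kernel-verified Lean document; each statement's English description precedes it below -/
import Mathlib

section
/- For every r ≥ 1, the polynomial identity A_{r+2}(X) = -A_{r+1}(X) - X^{q^r}·A_r(X) holds. -/
open Polynomial

noncomputable abbrev Kbar (p : ℕ) [Fact p.Prime] : Type := AlgebraicClosure (ZMod p)

noncomputable def A (q : ℕ) (K : Type) [Field K] : ℕ → Polynomial K
  | 0 => 0
  | 1 => 1
  | 2 => -1
  | (r+3) => -(A q K (r+2))^q - X^q * (A q K (r+1))^(q^2)


theorem A_add_three (q : ℕ) (K : Type) [Field K] (r : ℕ) :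
    A q K (r + 3) = -(A q K (r + 2)) ^ q - X ^ q * (A q K (r + 1)) ^ (q ^ 2) := by
  rw [A]

/-- The second recursion, for any `q` such that `q`-th powers are given by a ring homomorphism. -/
theorem A_recursion_of_ringHom (q : ℕ) (K : Type) [Field K] (φ : K[X] →+* K[X])
    (hφ : ∀ f, φ f = f ^ q) (r : ℕ) :
    A q K (r + 3) = -(A q K (r + 2)) - X ^ q ^ (r + 1) * A q K (r + 1) := by
  have h_one : (-1 : K[X]) ^ q = -1 := by rw [← hφ, map_neg, map_one]
  have h_sub (f g : K[X]) : (-f - g) ^ q = -f ^ q - g ^ q := by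
    rw [← hφ, map_sub, map_neg, hφ, hφ]
  have h_sub_sq (f g : K[X]) : (-f - g) ^ (q ^ 2) = -f ^ (q ^ 2) - g ^ (q ^ 2) := by
    simp only [sq, pow_mul, h_sub]
  have h_two : A q K 2 = -1 := by rw [A]
  have h_three : A q K 3 = 1 - X ^ q := by
    rw [A_add_three q K 0]
    simp [A, h_one]
  induction r using Nat.strong_induction_on with
  | _ r ih =>
    match r with
    | 0 =>
      rw [h_three]
      simp [A]
    | 1 =>
      have h_one_sq : (-1 : K[X]) ^ (q ^ 2) = -1 := by rw [sq, pow_mul, h_one, h_one]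
      have h_pow : (1 - X ^ q : K[X]) ^ q = 1 - X ^ (q ^ 2) := by
        rw [← hφ, map_sub, map_one, hφ, ← pow_mul, sq]
      rw [A_add_three q K 1]
      simp only [Nat.reduceAdd, h_three, h_two, h_one_sq, h_pow]
      ring
    | r + 2 =>
      have h_fst := congrArg (· ^ q) (ih (r + 1) (by omega))
      have h_snd := congrArg (· ^ (q ^ 2)) (ih r (by omega))
      simp only [h_sub, h_sub_sq, mul_pow, ← pow_mul, ← pow_succ, ← pow_add] at h_fst h_snd
      have h_four := A_add_three q K (r + 1)
      have h_five := A_add_three q K r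
      rw [A_add_three q K (r + 2)]
      linear_combination -h_fst - X ^ q * h_snd + h_four + X ^ q ^ (r + 3) * h_five

/-- For `r ≥ 1`, `A_{r+2}(X) = -A_{r+1}(X) - X^{q^r}·A_r(X)` where `q = p^k`. -/
theorem statement_1 (p k q : ℕ) [Fact p.Prime] (hk : 0 < k) (hq : q = p ^ k)
    (r : ℕ) (hr : 1 ≤ r) :
    A q (ZMod p) (r + 2) = -(A q (ZMod p) (r + 1)) - X ^ q ^ r * A q (ZMod p) r := by
  obtain ⟨n, rfl⟩ := Nat.exists_eq_add_of_le' hr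
  refine A_recursion_of_ringHom q (ZMod p) (iterateFrobenius (ZMod p)[X] p k) (fun f => ?_) n
  rw [iterateFrobenius_def, hq]
end

section
/- For every r ≥ 1, the polynomial identity A_{r+1}(X)^{q+1} - A_r(X)^q·A_{r+2}(X) = X^{q(q^r-1)/(q-1)} holds. -/
open Polynomial

/-- The exponent in the identity is `q` times a geometric sum. -/
theorem mul_pow_sub_one_div (q r : ℕ) (hq : 2 ≤ q) :
    q * (q ^ r - 1) / (q - 1) = q * ∑ i ∈ Finset.range r, q ^ i := by
  rw [Nat.geomSum_eq hq, Nat.mul_div_assoc _ (Nat.sub_one_dvd_pow_sub_one q r)]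

theorem A_pow_sub_mul (p k : ℕ) [Fact p.Prime] (K : Type) [Field K] [CharP K p] (r : ℕ) :
    (A (p ^ k) K (r + 2)) ^ (p ^ k + 1) - (A (p ^ k) K (r + 1)) ^ (p ^ k) * A (p ^ k) K (r + 3)
      = X ^ (p ^ k * ∑ i ∈ Finset.range (r + 1), (p ^ k) ^ i) := by
  induction r with
  | zero =>
    have h : (-1 : K[X]) ^ (p ^ k) = -1 := neg_one_pow_expChar_pow K[X] p k
    rw [A_add_three]
    simp [A, pow_succ (-1 : K[X]), h]
  | succ r ih =>
    have e : p ^ k * ∑ i ∈ Finset.range (r + 1 + 1), (p ^ k) ^ i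
        = p ^ k + p ^ k * (∑ i ∈ Finset.range (r + 1), (p ^ k) ^ i) * p ^ k := by
      rw [geom_sum_succ]
      ring
    rw [e, pow_add X, pow_mul X _ (p ^ k), ← ih, sub_pow_expChar_pow, A_add_three _ _ (r + 1)]
    have h3 := A_add_three (p ^ k) K r
    generalize p ^ k = q at *
    linear_combination (A q K (r + 3)) ^ q * h3

/-- For `r ≥ 1`, `A_{r+1}(X)^{q+1} - A_r(X)^q·A_{r+2}(X) = X^{q(q^r-1)/(q-1)}` where `q = p^k`. -/
theorem statement_2 (p k q : ℕ) [Fact p.Prime] (hk : 0 < k) (hq : q = p ^ k)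
    (r : ℕ) (hr : 1 ≤ r) :
    (A q (ZMod p) (r + 1)) ^ (q + 1) - (A q (ZMod p) r) ^ q * A q (ZMod p) (r + 2)
      = X ^ (q * (q ^ r - 1) / (q - 1)) := by
  subst hq
  obtain ⟨r, rfl⟩ := Nat.exists_eq_add_of_le' hr
  have hp : 2 ≤ p := (Fact.out : p.Prime).two_le
  rw [mul_pow_sub_one_div _ _ (hp.trans (Nat.le_self_pow hk.ne' p))]
  exact A_pow_sub_mul p k (ZMod p) r
end

section
/- For any r ≥ 3, the set of zeros of A_r in the algebraic closure of GF(p) is exactly { (u - u^q)^{q^2+1} / (u - u^{q^2})^{q+1} : u ∈ GF(q^r) \ GF(q^2) }. -/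
open Polynomial

/-- Closed form for a Frobenius-twisted linear recurrence along the orbit `u 0, u 1, …` of an
endomorphism `F` of a field. -/
theorem twisted_recurrence_closed_form {K : Type*} [Field K] (F : K →+* K) (u a : ℕ → K) (x : K)
    (hu : ∀ n, F (u n) = u (n + 1)) (h01 : u 0 ≠ u 1) (h02 : u 0 ≠ u 2)
    (hx : x = (u 0 - u 1) * (u 2 - u 3) / ((u 0 - u 2) * (u 1 - u 3)))
    (ha0 : a 0 = 1) (ha1 : a 1 = -1)
    (ha : ∀ n, a (n + 2) = -F (a (n + 1)) - F x * F (F (a n))) (n : ℕ) :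
    a n = (-1) ^ n * ((u 1 - u (n + 2)) / (u 1 - u 2)) *
      ∏ i ∈ Finset.range n, (u (i + 1) - u (i + 2)) / (u (i + 1) - u (i + 3)) := by
  have step : ∀ i j, u i ≠ u j → u (i + 1) ≠ u (j + 1) := by
    intro i j h h'
    rw [← hu, ← hu] at h'
    exact h (F.injective h')
  have h12 : u 1 - u 2 ≠ 0 := sub_ne_zero.mpr (step 0 1 h01)
  have h23 : u 2 - u 3 ≠ 0 := sub_ne_zero.mpr (step 1 2 (step 0 1 h01))
  have h34 : u 3 - u 4 ≠ 0 := sub_ne_zero.mpr (step 2 3 (step 1 2 (step 0 1 h01)))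
  have h13 : u 1 - u 3 ≠ 0 := sub_ne_zero.mpr (step 0 2 h02)
  have h24 : u 2 - u 4 ≠ 0 := sub_ne_zero.mpr (step 1 3 (step 0 2 h02))
  induction n using Nat.twoStepInduction with
  | zero => simp [ha0, h12]
  | one =>
    simp only [ha1, Finset.prod_range_one]
    norm_num
    field_simp
  | more n ih₁ ih₂ =>
    rw [ha, ih₁, ih₂, hx, Finset.prod_range_succ' _ n, Finset.prod_range_succ' _ (n + 1),
      Finset.prod_range_succ' _ n]
    simp only [map_mul, map_div₀, map_sub, map_pow, map_neg, map_one, map_prod, hu]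
    simp only [add_assoc, Nat.reduceAdd, zero_add]
    generalize (∏ i ∈ Finset.range n, (u (i + 3) - u (i + 4)) / (u (i + 3) - u (i + 5))) = P
    field_simp
    ring

/-- The classical parametrization: every nonzero element of an algebraically closed field of
characteristic `p` arises from some `u` outside `GF(q ^ 2)`. -/
theorem exists_frobenius_cross_ratio {K : Type*} [Field K] [IsAlgClosed K] (p k q : ℕ)
    [Fact p.Prime] [CharP K p] (hk : 0 < k) (hq : q = p ^ k) (x : K) (hx : x ≠ 0) :
    ∃ u : K, u ^ q ^ 2 ≠ u ∧ x = (u - u ^ q) ^ (q ^ 2 + 1) / (u - u ^ q ^ 2) ^ (q + 1) := by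
  have hq1 : 1 < q := hq ▸ Nat.one_lt_pow hk.ne' (Fact.out : p.Prime).one_lt
  obtain ⟨y, hy⟩ : ∃ y : K, y ^ q = x * (1 + y) ^ (q + 1) := by
    have hlt : (X ^ q : K[X]).natDegree < (C x * (X + C 1) ^ (q + 1)).natDegree := by
      rw [natDegree_C_mul hx, natDegree_pow_X_add_C, natDegree_X_pow]
      exact q.lt_succ_self
    obtain ⟨y, hy⟩ := IsAlgClosed.exists_root (C x * (X + C 1) ^ (q + 1) - X ^ q : K[X]) (by
      apply ne_of_gt
      rw [← natDegree_pos_iff_degree_pos, natDegree_sub_eq_left_of_natDegree_lt hlt]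
      exact (Nat.zero_le _).trans_lt hlt)
    refine ⟨y, ?_⟩
    simp [IsRoot] at hy
    rw [add_comm 1 y]
    linear_combination -hy
  have hy0 : y ≠ 0 := by
    rintro rfl
    simp [show q ≠ 0 by omega] at hy
    exact hx hy.symm
  have hy1 : 1 + y ≠ 0 := by
    intro h
    rw [h, zero_pow q.succ_ne_zero, mul_zero] at hy
    exact hy0 (eq_zero_of_pow_eq_zero hy)
  obtain ⟨v, hv⟩ := IsAlgClosed.exists_pow_nat_eq y (Nat.sub_pos_of_lt hq1)
  have hv0 : v ≠ 0 := by
    rintro rfl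
    rw [zero_pow (by omega)] at hv
    exact hy0 hv.symm
  obtain ⟨u, hu⟩ : ∃ u : K, u - u ^ q = v := by
    have hlt : (X - C v : K[X]).natDegree < (X ^ q : K[X]).natDegree := by
      rw [natDegree_X_sub_C, natDegree_X_pow]
      exact hq1
    obtain ⟨u, hu⟩ := IsAlgClosed.exists_root (X ^ q - (X - C v) : K[X]) (by
      apply ne_of_gt
      rw [← natDegree_pos_iff_degree_pos, natDegree_sub_eq_left_of_natDegree_lt hlt]
      exact (Nat.zero_le _).trans_lt hlt)
    refine ⟨u, ?_⟩
    simp [IsRoot] at hu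
    linear_combination -hu
  have hvq : v ^ q = v * y := by
    rw [← hv, ← pow_succ', Nat.sub_add_cancel hq1.le]
  have hw : u - u ^ q ^ 2 = v * (1 + y) := by
    have h : v ^ q = u ^ q - u ^ q ^ 2 := by
      rw [← hu, hq, sub_pow_char_pow, ← hq, ← pow_mul, ← sq]
    linear_combination hu - h + hvq
  have hvq2 : v ^ q ^ 2 = v * y * y ^ q := by
    rw [sq, pow_mul, hvq, mul_pow, hvq]
  refine ⟨u, fun h => mul_ne_zero hv0 hy1 ?_, ?_⟩
  · rw [← hw, h, sub_self]
  · rw [hu, hw, eq_div_iff (pow_ne_zero _ (mul_ne_zero hv0 hy1)), pow_succ v, hvq2, hy, mul_pow,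
      pow_succ v, hvq]
    ring

/-- For `u` outside `GF(q ^ 2)`, the associated point is a zero of `A_{r+1}` iff `u ∈ GF(q ^ (r+1))`. -/
theorem eval_A_eq_zero_iff {K : Type} [Field K] (p k q : ℕ) [Fact p.Prime] [CharP K p]
    (hq : q = p ^ k) (u : K) (hu : u ^ q ^ 2 ≠ u) (r : ℕ) :
    (A q K (r + 1)).eval ((u - u ^ q) ^ (q ^ 2 + 1) / (u - u ^ q ^ 2) ^ (q + 1)) = 0 ↔
      u ^ q ^ (r + 1) = u := by
  set x := (u - u ^ q) ^ (q ^ 2 + 1) / (u - u ^ q ^ 2) ^ (q + 1) with hx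
  let F : K →+* K := iterateFrobenius K p k
  have hF : ∀ y, F y = y ^ q := fun y => by rw [hq]; exact iterateFrobenius_def p k y
  have hFu : ∀ n, F (u ^ q ^ n) = u ^ q ^ (n + 1) := fun n => by rw [hF, ← pow_mul, ← pow_succ]
  have h01 : u ^ q ^ 0 ≠ u ^ q ^ 1 := by
    intro h
    rw [pow_zero, pow_one, pow_one] at h
    exact hu (by rw [sq, pow_mul, ← h, ← h])
  have h02 : u ^ q ^ 0 ≠ u ^ q ^ 2 := by
    rw [pow_zero, pow_one]
    exact hu.symm
  have step : ∀ i j, F (u ^ q ^ i - u ^ q ^ j) = u ^ q ^ (i + 1) - u ^ q ^ (j + 1) :=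
    fun i j => by rw [map_sub, hFu, hFu]
  have hx' : x = (u ^ q ^ 0 - u ^ q ^ 1) * (u ^ q ^ 2 - u ^ q ^ 3) /
      ((u ^ q ^ 0 - u ^ q ^ 2) * (u ^ q ^ 1 - u ^ q ^ 3)) := by
    rw [← step 1 2, ← step 0 1, ← step 0 2, hF, hF, hF, ← pow_mul, ← sq, hx]
    simp only [pow_zero, pow_one]
    ring
  have key := twisted_recurrence_closed_form F (fun n => u ^ q ^ n)
    (fun n => (A q K (n + 1)).eval x) x hFu h01 h02 hx' (by simp [A]) (by simp [A])
    (fun n => by simp [A, hF, ← pow_mul, sq]) r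
  have hne : ∀ i j, u ^ q ^ i ≠ u ^ q ^ j → u ^ q ^ (i + 1) ≠ u ^ q ^ (j + 1) := by
    intro i j h h'
    rw [← hFu, ← hFu] at h'
    exact h (F.injective h')
  have h01' : ∀ n, u ^ q ^ n ≠ u ^ q ^ (n + 1) := fun n => by
    induction n with
    | zero => exact h01
    | succ n ih => exact hne _ _ ih
  have h02' : ∀ n, u ^ q ^ n ≠ u ^ q ^ (n + 2) := fun n => by
    induction n with
    | zero => exact h02
    | succ n ih => exact hne _ _ ih
  have hprod : ∏ i ∈ Finset.range r, (u ^ q ^ (i + 1) - u ^ q ^ (i + 2)) /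
      (u ^ q ^ (i + 1) - u ^ q ^ (i + 3)) ≠ 0 :=
    Finset.prod_ne_zero_iff.mpr fun i _ =>
      div_ne_zero (sub_ne_zero.mpr (h01' _)) (sub_ne_zero.mpr (h02' _))
  rw [key, mul_eq_zero, mul_eq_zero, div_eq_zero_iff, or_iff_left hprod,
    or_iff_right (pow_ne_zero _ (neg_ne_zero.mpr one_ne_zero)),
    or_iff_left (sub_ne_zero.mpr (h01' 1)), sub_eq_zero]
  constructor
  · intro h
    by_contra h'
    refine hne 0 (r + 1) ?_ h
    rw [pow_zero, pow_one]
    exact Ne.symm h'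
  · intro h
    rw [← hFu (r + 1), h, hF, pow_one]

theorem eval_zero_A {K : Type} [Field K] {q : ℕ} (hq : q ≠ 0) (r : ℕ) :
    (A q K (r + 1)).eval 0 ≠ 0 := by
  induction r using Nat.twoStepInduction with
  | zero => simp [A]
  | one => simp [A]
  | more n _ ih => simpa [A, hq] using ih

/-- For `r ≥ 3`, the zeros of `A_r` in the algebraic closure of GF(p) are exactly the elements
`(u - u^q)^{q^2+1} / (u - u^{q^2})^{q+1}` for `u ∈ GF(q^r) \ GF(q^2)`, where an element lies in
`GF(p^s)` iff it is fixed by `x ↦ x^{p^s}` (and `q = p^k`). -/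
theorem statement_3 (p k q : ℕ) [Fact p.Prime] (hk : 0 < k) (hq : q = p ^ k)
    (r : ℕ) (hr : 3 ≤ r) :
    {x : Kbar p | (A q (Kbar p) r).eval x = 0}
      = {x : Kbar p | ∃ u : Kbar p, u ^ q ^ r = u ∧ ¬ u ^ q ^ 2 = u ∧
          x = (u - u ^ q) ^ (q ^ 2 + 1) / (u - u ^ q ^ 2) ^ (q + 1)} := by
  have hq0 : q ≠ 0 := hq ▸ pow_ne_zero k (Fact.out : p.Prime).ne_zero
  have : CharP (Kbar p) p := charP_of_injective_algebraMap (algebraMap (ZMod p) (Kbar p)).injective p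
  obtain ⟨r, rfl⟩ : ∃ s, r = s + 1 := ⟨r - 1, by omega⟩
  ext x
  simp only [Set.mem_ofPred_eq]
  constructor
  · intro h
    have hx : x ≠ 0 := by
      rintro rfl
      exact eval_zero_A hq0 r h
    obtain ⟨u, hu, rfl⟩ := exists_frobenius_cross_ratio p k q hk hq x hx
    exact ⟨u, (eval_A_eq_zero_iff p k q hq u hu r).mp h, hu, rfl⟩
  · rintro ⟨u, hur, hu, rfl⟩
    exact (eval_A_eq_zero_iff p k q hq u hu r).mpr hur
end

section
/- Let a ∈ GF(Q) be nonzero and let x ∈ GF(Q) satisfy x^{q+1} + x + a = 0. Then F(a)·x^2 + G(a)·x + a·F(a)^q = 0. -/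
open Polynomial

theorem A_eval_add_two {q : ℕ} (hq : q ≠ 0) {K : Type} [Field K] (a : K) (r : ℕ) :
    (A q K (r + 2)).eval a =
      -((A q K (r + 1)).eval a) ^ q - a ^ q * (((A q K r).eval a) ^ q) ^ q := by
  cases r with
  | zero => simp [A, hq]
  | succ r => simp [A, pow_two, pow_mul]

/-- The iterates `x ^ q ^ r` of a root of `X ^ (q + 1) + X + a` are fractional linear in `x`, with
coefficients given by the polynomials `A`. -/
theorem pow_mul_A_eval {p k : ℕ} [Fact p.Prime] {K : Type} [Field K] [CharP K p] {a x : K}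
    (hx : x ^ (p ^ k + 1) + x + a = 0) (r : ℕ) :
    x ^ (p ^ k) ^ (r + 1) * ((A (p ^ k) K (r + 1)).eval a * x
        - a * ((A (p ^ k) K r).eval a) ^ p ^ k)
      = (A (p ^ k) K (r + 2)).eval a * x - a * ((A (p ^ k) K (r + 1)).eval a) ^ p ^ k := by
  have hq : p ^ k ≠ 0 := pow_ne_zero _ (Fact.out : p.Prime).ne_zero
  have hsub (u v : K) : (u - v) ^ p ^ k = u ^ p ^ k - v ^ p ^ k := sub_pow_char_pow u v k
  generalize p ^ k = q at *
  induction r with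
  | zero =>
    simp only [A, eval_zero, eval_one, eval_neg, zero_pow hq, one_pow, zero_add, pow_one]
    linear_combination hx
  | succ r ih =>
    have h := congrArg (· ^ q) ih
    simp only [mul_pow, hsub] at h
    rw [← pow_mul, ← pow_succ] at h
    have e₁ := A_eval_add_two hq a r
    have e₂ := A_eval_add_two hq a (r + 1)
    simp only [add_assoc, Nat.reduceAdd] at e₁ e₂ h ⊢
    rw [pow_succ] at hx
    linear_combination x * h + x ^ q ^ (r + 2) * x * e₁ - x * e₂
      - x ^ q ^ (r + 2) * (A q K (r + 1)).eval a ^ q * hx + (A q K (r + 2)).eval a ^ q * hx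

/-- Let `a ∈ GF(Q)` be nonzero and `x ∈ GF(Q)` with `x^{q+1} + x + a = 0`. Then
`F(a)·x² + G(a)·x + a·F(a)^q = 0`, where `F = A_m` and `G(a) = -A_{m+1}(a) - a·A_{m-1}(a)^q`,
`q = p^k`, `Q = p^n`, `d = gcd(n,k)`, `m = n/d`.  Membership in `GF(p^s)` is expressed as
being fixed by `x ↦ x^{p^s}`. -/
theorem statement_5 (p k n d m q Q : ℕ) [Fact p.Prime] (hk : 0 < k) (hn : 0 < n)
    (hd : d = Nat.gcd n k) (hm : m = n / d) (hq : q = p ^ k) (hQ : Q = p ^ n)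
    (a : Kbar p) (haQ : a ^ Q = a) (ha0 : a ≠ 0)
    (x : Kbar p) (hxQ : x ^ Q = x) (hPx : x ^ (q + 1) + x + a = 0) :
    (A q (Kbar p) m).eval a * x ^ 2
      + (-(A q (Kbar p) (m + 1)).eval a - a * ((A q (Kbar p) (m - 1)).eval a) ^ q) * x
      + a * ((A q (Kbar p) m).eval a) ^ q = 0 := by
  subst hq hQ
  have hdn : d ∣ n := hd ▸ Nat.gcd_dvd_left n k
  have hm0 : 0 < m := by
    rw [hm]
    exact Nat.div_pos (Nat.le_of_dvd hn hdn) (Nat.pos_of_dvd_of_pos hdn hn)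
  have hnkm : n ∣ k * m := by
    obtain ⟨c, hc⟩ : d ∣ k := hd ▸ Nat.gcd_dvd_right n k
    exact ⟨c, by rw [hc, hm, mul_right_comm, Nat.mul_div_cancel' hdn]⟩
  have hxm : x ^ (p ^ k) ^ m = x := by
    obtain ⟨c, hc⟩ := hnkm
    rw [← pow_mul, hc, pow_mul]
    clear hc
    induction c with
    | zero => simp
    | succ c ih => rw [pow_succ, pow_mul, ih, hxQ]
  obtain ⟨r, rfl⟩ : ∃ r, m = r + 1 := ⟨m - 1, by omega⟩
  have h := pow_mul_A_eval hPx r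
  rw [hxm] at h
  rw [Nat.add_sub_cancel]
  linear_combination h
end

section
/- For any x in the algebraic closure of GF(p) with x^{q^m} = x (i.e., x ∈ GF(q^m)), one has ( G(x) - 2·F(x) )^q = -G(x). -/
open Polynomial

theorem A_add_two (q : ℕ) (K : Type) [Field K] (r : ℕ) (hq : q ≠ 0) :
    A q K (r + 2) = -(A q K (r + 1)) ^ q - X ^ q * (A q K r) ^ (q ^ 2) := by
  cases r with
  | zero => simp [A, hq]
  | succ r => simp [A]

theorem eval_A_add_two {q : ℕ} {K : Type} [Field K] (σ : K →+* K) (hσ : ∀ y, σ y = y ^ q)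
    (hq : q ≠ 0) (x : K) (r : ℕ) :
    (A q K (r + 2)).eval x
      = -σ ((A q K (r + 1)).eval x) - σ x * σ (σ ((A q K r).eval x)) := by
  rw [A_add_two q K r hq]
  simp [hσ, ← pow_mul, sq]

/-- The continuant recurrence for `A` expanded at the last variable instead of the first. -/
theorem eval_A_add_two_last {q : ℕ} {K : Type} [Field K] (σ : K →+* K)
    (hσ : ∀ y, σ y = y ^ q) (hq : q ≠ 0) (x : K) (r : ℕ) :
    (A q K (r + 2)).eval x
      = -(A q K (r + 1)).eval x - x ^ q ^ r * (A q K r).eval x := by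
  have hx (i : ℕ) : σ (x ^ q ^ i) = x ^ q ^ (i + 1) := by rw [hσ, ← pow_mul, pow_succ]
  induction r using Nat.twoStepInduction with
  | zero => simp [A]
  | one => rw [eval_A_add_two σ hσ hq]; simp [A, hσ x]
  | more r ih₀ ih₁ =>
    have e₁ := congrArg σ ih₁
    have e₀ := congrArg (fun y => σ (σ y)) ih₀
    simp only [map_sub, map_neg, map_mul, hx] at e₀ e₁
    have h₄ := eval_A_add_two σ hσ hq x (r + 2)
    have h₃ := eval_A_add_two σ hσ hq x (r + 1)
    have h₂ := eval_A_add_two σ hσ hq x r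
    linear_combination h₄ - e₁ - σ x * e₀ + h₃ + x ^ q ^ (r + 2) * h₂

/-- For any `x` in the algebraic closure of GF(p) with `x^{q^m} = x`,
`(G(x) - 2·F(x))^q = -G(x)`, where `F(x) = A_m(x)`,
`G(x) = -A_{m+1}(x) - x·A_{m-1}(x)^q`, `q = p^k`, `d = gcd(n,k)`, `m = n/d`. -/
theorem statement_7 (p k n d m q : ℕ) [Fact p.Prime] (hk : 0 < k) (hn : 0 < n)
    (hd : d = Nat.gcd n k) (hm : m = n / d) (hq : q = p ^ k)
    (x : Kbar p) (hx : x ^ q ^ m = x) :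
    ((-(A q (Kbar p) (m + 1)).eval x - x * ((A q (Kbar p) (m - 1)).eval x) ^ q)
        - 2 * (A q (Kbar p) m).eval x) ^ q
      = -(-(A q (Kbar p) (m + 1)).eval x - x * ((A q (Kbar p) (m - 1)).eval x) ^ q) := by
  have hp : p.Prime := Fact.out
  have hq0 : q ≠ 0 := hq ▸ pow_ne_zero k hp.ne_zero
  have hm0 : 0 < m := by
    subst hm hd
    exact Nat.div_pos (Nat.gcd_le_left k hn) (Nat.gcd_pos_of_pos_left k hn)
  obtain ⟨s, rfl⟩ := Nat.exists_eq_add_one.mpr hm0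
  let σ : Kbar p →+* Kbar p := iterateFrobenius (Kbar p) p k
  have hσ (y : Kbar p) : σ y = y ^ q := by rw [hq]; exact iterateFrobenius_def p k y
  have first := eval_A_add_two σ hσ hq0 x s
  have last := congrArg σ (eval_A_add_two_last σ hσ hq0 x s)
  have hx' : σ (x ^ q ^ s) = x := by rw [hσ, ← pow_mul, ← pow_succ, hx]
  simp only [map_sub, map_neg, map_mul, hx'] at last
  simp only [← hσ, Nat.add_sub_cancel, map_sub, map_neg, map_mul, map_ofNat]
  linear_combination -first - last
end

section
/- For any x in the algebraic closure of GF(p) with x^{q^m} = x (i.e., x ∈ GF(q^m)), the element G(x)^2 - 4·x·F(x)^{q+1} lies in GF(q). -/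
open Polynomial

section TwistedRecurrence

variable {R : Type*} [CommRing R] {σ : R →+* R} {x : R} {a : ℕ → R}

/-- A sequence defined by a recurrence twisted by `σ` also satisfies an untwisted one. -/
theorem twisted_recurrence_untwist (h0 : a 0 = 0) (h1 : a 1 = 1)
    (h : ∀ r, a (r + 2) = -σ (a (r + 1)) - σ x * σ (σ (a r))) (r : ℕ) :
    a (r + 2) = -a (r + 1) - σ^[r] x * a r := by
  induction r using Nat.twoStepInduction with
  | zero => simp [h 0, h0, h1]
  | one => simp [h 1, h 0, h0, h1]
  | more r ih ih' =>
    have e := congrArg σ ih'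
    have e' := congrArg σ (congrArg σ ih)
    simp only [map_sub, map_neg, map_mul, ← Function.iterate_succ_apply' σ] at e e'
    simp only [Function.iterate_succ_apply' σ] at e e' ⊢
    linear_combination h (r + 2) - e - σ x * e' + h (r + 1) + σ (σ (σ^[r] x)) * h r

theorem twisted_recurrence_casoratian (h0 : a 0 = 0) (h1 : a 1 = 1)
    (h : ∀ r, a (r + 2) = -σ (a (r + 1)) - σ x * σ (σ (a r))) (r : ℕ) :
    a (r + 1) * σ (a (r + 1)) - a (r + 2) * σ (a r) =
      ∏ i ∈ Finset.range r, σ^[i + 1] x := by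
  induction r with
  | zero => simp [h0, h1]
  | succ r ih =>
    have e := congrArg σ (twisted_recurrence_untwist h0 h1 h r)
    have e' := twisted_recurrence_untwist h0 h1 h (r + 1)
    simp only [map_sub, map_neg, map_mul, ← Function.iterate_succ_apply' σ] at e
    rw [Finset.prod_range_succ, ← ih]
    linear_combination a (r + 2) * e - σ (a (r + 1)) * e'

/-- The discriminant of the monodromy of a twisted recurrence is fixed by `σ`. -/
theorem twisted_recurrence_discriminant_fixed (h0 : a 0 = 0) (h1 : a 1 = 1)
    (h : ∀ r, a (r + 2) = -σ (a (r + 1)) - σ x * σ (σ (a r))) (r : ℕ)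
    (hx : σ^[r + 1] x = x) :
    σ ((-a (r + 2) - x * σ (a r)) ^ 2 - 4 * x * (a (r + 1) * σ (a (r + 1)))) =
      (-a (r + 2) - x * σ (a r)) ^ 2 - 4 * x * (a (r + 1) * σ (a (r + 1))) := by
  have trace_fixed : σ (a (r + 2) - x * σ (a r)) = a (r + 2) - x * σ (a r) := by
    have e := congrArg σ (twisted_recurrence_untwist h0 h1 h r)
    simp only [map_sub, map_neg, map_mul, ← Function.iterate_succ_apply' σ, hx] at e ⊢
    linear_combination e - h r
  have det_fixed : σ (x * (a (r + 1) * σ (a (r + 1)) - a (r + 2) * σ (a r))) =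
      x * (a (r + 1) * σ (a (r + 1)) - a (r + 2) * σ (a r)) := by
    rw [twisted_recurrence_casoratian h0 h1 h r, map_mul, map_prod]
    simp only [← Function.iterate_succ_apply' σ]
    have e := Finset.prod_range_succ' (fun i => σ^[i + 1] x) r
    rw [Finset.prod_range_succ, hx] at e
    simpa [mul_comm] using e.symm
  have disc : (-a (r + 2) - x * σ (a r)) ^ 2 - 4 * x * (a (r + 1) * σ (a (r + 1))) =
      (a (r + 2) - x * σ (a r)) ^ 2 -
        4 * (x * (a (r + 1) * σ (a (r + 1)) - a (r + 2) * σ (a r))) := by ring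
  rw [disc, map_sub, map_pow, trace_fixed, map_mul, det_fixed, map_ofNat]

end TwistedRecurrence

/-- For any `x` in the algebraic closure of GF(p) with `x^{q^m} = x`, the element
`G(x)² - 4·x·F(x)^{q+1}` lies in `GF(q)` (i.e. is fixed by `y ↦ y^q`), where `F(x) = A_m(x)`,
`G(x) = -A_{m+1}(x) - x·A_{m-1}(x)^q`, `q = p^k`, `d = gcd(n,k)`, `m = n/d`. -/
theorem statement_8 (p k n d m q : ℕ) [Fact p.Prime] (hk : 0 < k) (hn : 0 < n)
    (hd : d = Nat.gcd n k) (hm : m = n / d) (hq : q = p ^ k)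
    (x : Kbar p) (hx : x ^ q ^ m = x) :
    ((-(A q (Kbar p) (m + 1)).eval x - x * ((A q (Kbar p) (m - 1)).eval x) ^ q) ^ 2
        - 4 * x * ((A q (Kbar p) m).eval x) ^ (q + 1)) ^ q
      = (-(A q (Kbar p) (m + 1)).eval x - x * ((A q (Kbar p) (m - 1)).eval x) ^ q) ^ 2
        - 4 * x * ((A q (Kbar p) m).eval x) ^ (q + 1) := by
  have m_pos : 0 < m := by
    rw [hm, hd]
    exact Nat.div_pos (Nat.gcd_le_left k hn) (Nat.gcd_pos_of_pos_left k hn)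
  obtain ⟨r, rfl⟩ := Nat.exists_eq_add_of_lt m_pos
  rw [zero_add] at hx ⊢
  set σ : Kbar p →+* Kbar p := iterateFrobenius (Kbar p) p k with hσ
  have σ_apply (y : Kbar p) : σ y = y ^ q := by rw [hσ, iterateFrobenius_def, hq]
  have σ_iterate (i : ℕ) : σ^[i] x = x ^ q ^ i := by
    induction i with
    | zero => simp
    | succ i ih => rw [Function.iterate_succ_apply', ih, σ_apply, ← pow_mul, ← pow_succ]
  have key := twisted_recurrence_discriminant_fixed (σ := σ) (x := x)
    (a := fun r => (A q (Kbar p) r).eval x) (by simp [A]) (by simp [A])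
    (fun r => by
      cases r with
      | zero => simp [A]
      | succ r => simp [A, σ_apply, ← pow_mul, sq]) r (by rw [σ_iterate, hx])
  simp only [σ_apply] at key
  simpa only [Nat.add_sub_cancel, pow_succ' _ q] using key
end

section
/- Suppose p = 2. Let a ∈ GF(Q) with G(a) ≠ 0, set E = a·F(a)^{q+1}/G(a)^2 and H = Tr_{GF(2^d)/GF(2)}( N_{GF(Q)/GF(2^d)}(a) / G(a)^2 ). Then the absolute trace of E from GF(Q) to GF(2) equals m·H (computed modulo 2). -/
open Polynomial

/-- A sequence obeying the recursion of `A` at a point, for an endomorphism `σ` in place of the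
`q`-th power map, satisfies a determinant identity. -/
lemma continuant_det {R : Type*} [CommRing R] [CharP R 2] (σ : R →+* R) (a : R) (b : ℕ → R)
    (h0 : b 0 = 0) (h1 : b 1 = 1)
    (hb : ∀ r, b (r + 2) = σ (b (r + 1)) + σ a * σ (σ (b r))) (r : ℕ) :
    b (r + 1) * σ (b (r + 1)) + b (r + 2) * σ (b r) = ∏ i ∈ Finset.range r, σ^[i + 1] a := by
  induction r with
  | zero => simp [h0, h1]
  | succ r ih =>
    have hprod : ∏ i ∈ Finset.range (r + 1), σ^[i + 1] a
        = σ a * σ (∏ i ∈ Finset.range r, σ^[i + 1] a) := by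
      rw [Finset.prod_range_succ', map_prod, mul_comm]
      simp [Function.iterate_succ_apply']
    rw [hprod, ← ih, hb (r + 1)]
    simp only [map_add, map_mul]
    have h2 : (2 : R) = 0 := CharTwo.two_eq_zero
    linear_combination σ (b (r + 2)) * hb r + σ (b (r + 2)) * σ (b (r + 1)) * h2

lemma continuant_last {R : Type*} [CommRing R] (σ : R →+* R) (a : R) (b : ℕ → R)
    (h0 : b 0 = 0) (h1 : b 1 = 1)
    (hb : ∀ r, b (r + 2) = σ (b (r + 1)) + σ a * σ (σ (b r))) (r : ℕ) :
    b (r + 2) = b (r + 1) + σ^[r] a * b r := by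
  induction r using Nat.twoStepInduction with
  | zero => simp [hb 0, h0, h1]
  | one => simp [hb 1, hb 0, h0, h1]
  | more r ih1 ih2 =>
    have e1 := congrArg σ ih2
    have e2 := congrArg σ (congrArg σ ih1)
    simp only [map_add, map_mul, ← Function.iterate_succ_apply'] at e1 e2
    have e3 := hb (r + 2)
    have e4 := hb (r + 1)
    have e5 := hb r
    simp only [Nat.succ_eq_add_one, add_assoc, Nat.reduceAdd] at *
    linear_combination e3 + e1 + σ a * e2 - e4 - σ^[r + 2] a * e5

lemma continuant_cyclic {R : Type*} [CommRing R] (σ : R →+* R) (a : R) (b : ℕ → R)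
    (h0 : b 0 = 0) (h1 : b 1 = 1)
    (hb : ∀ r, b (r + 2) = σ (b (r + 1)) + σ a * σ (σ (b r))) (r : ℕ)
    (hr : σ^[r + 1] a = a) :
    σ (b (r + 2) + a * σ (b r)) = b (r + 2) + a * σ (b r) := by
  have e := congrArg σ (continuant_last σ a b h0 h1 hb r)
  simp only [map_add, map_mul, ← Function.iterate_succ_apply'] at e
  rw [Nat.succ_eq_add_one, hr] at e
  simp only [map_add, map_mul]
  linear_combination e - hb r

lemma eval_A_succ_succ (k : ℕ) (K : Type) [Field K] [CharP K 2] (a : K) (r : ℕ) :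
    (A (2 ^ k) K (r + 2)).eval a = iterateFrobenius K 2 k ((A (2 ^ k) K (r + 1)).eval a)
      + iterateFrobenius K 2 k a *
        iterateFrobenius K 2 k (iterateFrobenius K 2 k ((A (2 ^ k) K r).eval a)) := by
  cases r with
  | zero => simp [A, CharTwo.neg_eq]
  | succ r =>
    simp only [A, iterateFrobenius_def, eval_sub, eval_neg, eval_mul, eval_pow, eval_X,
      ← pow_mul, sq]
    rw [CharTwo.neg_eq, CharTwo.sub_eq_add]

lemma eval_A_pow_eq_self (k n : ℕ) (K : Type) [Field K] [CharP K 2] (a : K)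
    (ha : a ^ 2 ^ n = a) (r : ℕ) :
    ((A (2 ^ k) K r).eval a) ^ 2 ^ n = (A (2 ^ k) K r).eval a := by
  induction r using Nat.twoStepInduction with
  | zero => simp [A]
  | one => simp [A]
  | more r ih1 ih2 =>
    rw [eval_A_succ_succ, add_pow_char_pow, mul_pow]
    simp only [iterateFrobenius_def]
    simp only [pow_right_comm _ _ (2 ^ n), ih1, ih2, ha]

lemma pow_two_pow_gcd_eq_self {M : Type*} [Monoid M] {x : M} {n k : ℕ}
    (hn : x ^ 2 ^ n = x) (hk : x ^ 2 ^ k = x) : x ^ 2 ^ Nat.gcd n k = x := by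
  have h (j : ℕ) : Function.IsPeriodicPt (fun y : M => y ^ 2) j x ↔ x ^ 2 ^ j = x := by
    rw [Function.IsPeriodicPt, Function.IsFixedPt, pow_iterate]
  rw [← h] at *
  exact hn.gcd hk

lemma sum_range_add_sq_pow_two_pow {R : Type*} [CommRing R] [CharP R 2] (u : R) (n : ℕ) :
    ∑ i ∈ Finset.range n, (u ^ 2 + u) ^ 2 ^ i = u ^ 2 ^ n + u := by
  induction n with
  | zero => simp [CharTwo.add_self_eq_zero]
  | succ n ih =>
    rw [Finset.sum_range_succ, ih, add_pow_char_pow, ← pow_mul, ← pow_succ']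
    have h2 : (2 : R) = 0 := CharTwo.two_eq_zero
    linear_combination u ^ 2 ^ n * h2

lemma sum_range_mul_pow_two_pow {R : Type*} [CommRing R] {c : R} {d : ℕ}
    (hc : c ^ 2 ^ d = c) (m : ℕ) :
    ∑ i ∈ Finset.range (d * m), c ^ 2 ^ i = m * ∑ i ∈ Finset.range d, c ^ 2 ^ i := by
  have hper (m : ℕ) : c ^ 2 ^ (d * m) = c := by
    induction m with
    | zero => simp
    | succ m ih => rw [mul_add, mul_one, pow_add, pow_mul, ih, hc]
  induction m with
  | zero => simp
  | succ m ih =>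
    rw [mul_add, mul_one, Finset.sum_range_add, ih]
    have hshift (i : ℕ) : c ^ 2 ^ (d * m + i) = c ^ 2 ^ i := by
      rw [pow_add, pow_mul c, hper]
    simp only [hshift]
    push_cast
    ring

lemma prod_range_mul_eq_of_periodic {M : Type*} [CommMonoid M] {f : ℕ → M} {m l : ℕ}
    (hf : Function.Periodic f m) (hm : 0 < m) (hl : Nat.Coprime m l) :
    ∏ i ∈ Finset.range m, f (l * i) = ∏ i ∈ Finset.range m, f i := by
  have hmaps : Set.MapsTo (fun i => l * i % m) (Finset.range m : Set ℕ) (Finset.range m) :=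
    fun i _ => by simpa using Nat.mod_lt _ hm
  have hinj : Set.InjOn (fun i => l * i % m) (Finset.range m : Set ℕ) := by
    intro i hi j hj hij
    have h : i ≡ j [MOD m] := Nat.ModEq.cancel_left_of_coprime hl hij
    simp only [Finset.coe_range, Set.mem_Iio] at hi hj
    exact h.eq_of_lt_of_lt hi hj
  exact Finset.prod_nbij _ hmaps hinj (Finset.surjOn_of_injOn_of_card_le _ hmaps hinj le_rfl)
    fun i _ => (hf.map_mod_nat _).symm

/-- `p = 2`. For `a ∈ GF(Q)` with `G(a) ≠ 0`, setting `E = a·F(a)^{q+1}/G(a)²` and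
`H = Tr_{GF(2^d)/GF(2)}(N_{GF(Q)/GF(2^d)}(a)/G(a)²)`, the absolute trace of `E` from `GF(Q)`
to `GF(2)` equals `m·H` (mod 2).  Traces are written as sums of Frobenius powers and the norm
as the product of conjugates, all inside the algebraic closure of GF(2). -/
theorem statement_10 (k n d m q Q : ℕ) (hk : 0 < k) (hn : 0 < n)
    (hd : d = Nat.gcd n k) (hm : m = n / d) (hq : q = 2 ^ k) (hQ : Q = 2 ^ n)
    (a : Kbar 2) (haQ : a ^ Q = a)
    (Fa Ga Nr E H : Kbar 2)
    (hFa : Fa = (A q (Kbar 2) m).eval a)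
    (hGa : Ga = -(A q (Kbar 2) (m + 1)).eval a - a * ((A q (Kbar 2) (m - 1)).eval a) ^ q)
    (hGa0 : Ga ≠ 0)
    (hNr : Nr = ∏ i ∈ Finset.range m, a ^ (2 ^ d) ^ i)
    (hE : E = a * Fa ^ (q + 1) / Ga ^ 2)
    (hH : H = ∑ i ∈ Finset.range d, (Nr / Ga ^ 2) ^ 2 ^ i) :
    ∑ i ∈ Finset.range n, E ^ 2 ^ i = (m : Kbar 2) * H := by
  subst hq hQ
  have hd0 : 0 < d := hd ▸ Nat.gcd_pos_of_pos_left k hn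
  have hnm : n = d * m := by rw [hm, Nat.mul_div_cancel' (hd ▸ Nat.gcd_dvd_left n k)]
  obtain ⟨l, hl⟩ : d ∣ k := hd ▸ Nat.gcd_dvd_right n k
  have hm0 : 0 < m := Nat.pos_of_mul_pos_left (hnm ▸ hn)
  have hml : Nat.Coprime m l := by
    rw [hnm, hl, Nat.gcd_mul_left] at hd
    exact Nat.eq_of_mul_eq_mul_left hd0 (by rw [mul_one]; exact hd.symm)
  obtain ⟨r, rfl⟩ : ∃ r, m = r + 1 := ⟨m - 1, by omega⟩
  set σ := iterateFrobenius (Kbar 2) 2 k with hσ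
  set b : ℕ → Kbar 2 := fun r => (A (2 ^ k) (Kbar 2) r).eval a with hbdef
  have h0 : b 0 = 0 := by simp [hbdef, A]
  have h1 : b 1 = 1 := by simp [hbdef, A]
  have hb (r : ℕ) : b (r + 2) = σ (b (r + 1)) + σ a * σ (σ (b r)) := eval_A_succ_succ k _ a r
  have hbQ (r : ℕ) : b r ^ 2 ^ n = b r := eval_A_pow_eq_self k n _ a haQ r
  have hiter (i : ℕ) : σ^[i] a = a ^ (2 ^ d) ^ (l * i) := by
    have : ⇑σ = fun y => y ^ 2 ^ k := rfl
    rw [this, pow_iterate, ← pow_mul, ← pow_mul, hl, mul_assoc]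
  have hper : Function.Periodic (fun i => a ^ (2 ^ d) ^ i) (r + 1) := fun i => by
    simp only
    rw [pow_add, mul_comm, pow_mul, ← pow_mul 2 d (r + 1), ← hnm, haQ]
  have hcyc : σ^[r + 1] a = a := by
    rw [hiter]
    simpa using hper.nat_mul_eq l
  have hN : Nr = a * (b (r + 1) * σ (b (r + 1)) + b (r + 2) * σ (b r)) := by
    rw [continuant_det σ a b h0 h1 hb, hNr, ← prod_range_mul_eq_of_periodic hper hm0 hml,
      Finset.prod_range_succ', mul_comm]
    simp only [hiter, mul_zero, pow_zero, pow_one]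
  have hG : Ga = b (r + 2) + a * σ (b r) := by
    rw [hGa, CharTwo.neg_eq, CharTwo.sub_eq_add]
    rfl
  have hGk : Ga ^ 2 ^ k = Ga := by
    have := continuant_cyclic σ a b h0 h1 hb r hcyc
    rwa [← hG] at this
  have hGn : Ga ^ 2 ^ n = Ga := by
    rw [hG, add_pow_char_pow, mul_pow, haQ, hbQ, hσ, iterateFrobenius_def, pow_right_comm, hbQ]
  have hGd : Ga ^ 2 ^ d = Ga := hd ▸ pow_two_pow_gcd_eq_self hGn hGk
  have hNd : Nr ^ 2 ^ d = Nr := by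
    rw [hNr, ← Finset.prod_pow]
    have hstep (i : ℕ) : (a ^ (2 ^ d) ^ i) ^ 2 ^ d = a ^ (2 ^ d) ^ (i + 1) := by
      rw [← pow_mul a, ← pow_succ]
    simp only [hstep]
    rw [Finset.prod_range_succ, Finset.prod_range_succ', ← pow_mul 2 d (r + 1), ← hnm, haQ]
    simp
  have hcd : (Nr / Ga ^ 2) ^ 2 ^ d = Nr / Ga ^ 2 := by
    rw [div_pow, pow_right_comm, hGd, hNd]
  have hu : (b (r + 2) / Ga) ^ 2 ^ n = b (r + 2) / Ga := by
    rw [div_pow, hbQ, hGn]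
  have h2 : (2 : Kbar 2) = 0 := CharTwo.two_eq_zero
  have hF : Fa ^ (2 ^ k + 1) = b (r + 1) * σ (b (r + 1)) := by
    rw [hFa, pow_succ']
    rfl
  have hEu : E = Nr / Ga ^ 2 + ((b (r + 2) / Ga) ^ 2 + b (r + 2) / Ga) := by
    rw [hE, hF, hN]
    field_simp
    rw [hG]
    linear_combination -(b (r + 2) * b (r + 2) + a * b (r + 2) * σ (b r)) * h2
  rw [hEu]
  simp only [add_pow_char_pow (Nr / Ga ^ 2)]
  rw [Finset.sum_add_distrib, sum_range_add_sq_pow_two_pow, hu, CharTwo.add_self_eq_zero, add_zero,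
    hH, ← sum_range_mul_pow_two_pow hcd, ← hnm]
end

section
/- Let a ∈ GF(Q) be nonzero. Then the polynomial P_a(X) = X^{q+1} + X + a has exactly p^d + 1 zeros in GF(Q) if and only if F(a) = 0. -/
open Polynomial

section TwistedRecurrence

variable {F K : Type*} [Field F] [Field K] [Algebra F K] {τ : K ≃ₐ[F] K} {a : K} {α : ℕ → K}

/-- The recurrence `α (r + 2) = -τ (α (r + 1)) - τ a * τ² (α r)` can be rewritten so that `τ` acts
on the coefficient only. -/
theorem twisted_rec_left (h0 : α 0 = 0) (h1 : α 1 = 1)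
    (hα : ∀ r, α (r + 2) = -τ (α (r + 1)) - τ a * τ (τ (α r))) (i : ℕ) :
    α (i + 2) = -α (i + 1) - (τ ^ i) a * α i := by
  induction i using Nat.twoStepInduction with
  | zero => simp [hα, h0, h1]
  | one => simp [hα, h0, h1]
  | more i ih1 ih2 =>
    have e1 := congrArg τ ih2
    have e2 := congrArg (fun x => τ (τ x)) ih1
    simp only [map_sub, map_neg, map_mul] at e1 e2
    simp only [pow_succ', AlgEquiv.mul_apply] at e1 ⊢
    linear_combination hα (i + 2) - e1 - τ a * e2 + hα (i + 1) + τ (τ ((τ ^ i) a)) * hα i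

/-- A root of `x * τ x + x + a` satisfies `∏_{j ≤ i} τ^j x = α (i + 1) * x - a * τ (α i)`. -/
theorem prod_pow_apply_of_root (h0 : α 0 = 0) (h1 : α 1 = 1)
    (hα : ∀ r, α (r + 2) = -τ (α (r + 1)) - τ a * τ (τ (α r)))
    {x : K} (hx : x * τ x + x + a = 0) (i : ℕ) :
    ∏ j ∈ Finset.range (i + 1), (τ ^ j) x = α (i + 1) * x - a * τ (α i) := by
  have hl := twisted_rec_left h0 h1 hα
  induction i using Nat.twoStepInduction with
  | zero => simp [h0, h1]
  | one =>
    have := hl 0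
    simp only [zero_add, h0, h1] at this
    simp [Finset.prod_range_succ, this, h1]
    linear_combination hx
  | more i ih1 ih2 =>
    have hs : (τ ^ (i + 1)) x * (τ ^ (i + 2)) x = -(τ ^ (i + 1)) x - (τ ^ (i + 1)) a := by
      have := congrArg (τ ^ (i + 1)) hx
      simp only [map_add, map_mul, map_zero] at this
      rw [pow_succ τ (i + 1), AlgEquiv.mul_apply]
      linear_combination this
    have e := congrArg τ (hl i)
    simp only [map_sub, map_neg, map_mul, ← AlgEquiv.mul_apply τ, ← pow_succ'] at e
    rw [Finset.prod_range_succ, Finset.prod_range_succ, mul_assoc, hs, hl (i + 1), e]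
    rw [Finset.prod_range_succ] at ih2
    linear_combination (-(τ ^ (i + 1)) a) * ih1 - ih2

theorem eq_zero_of_three_roots (h0 : α 0 = 0) (h1 : α 1 = 1)
    (hα : ∀ r, α (r + 2) = -τ (α (r + 1)) - τ a * τ (τ (α r)))
    {m : ℕ} (hm : 0 < m) (hτ : τ ^ m = 1) {x y z : K} (hxy : x ≠ y) (hxz : x ≠ z) (hyz : y ≠ z)
    (hx : x * τ x + x + a = 0) (hy : y * τ y + y + a = 0) (hz : z * τ z + z + a = 0) :
    α m = 0 := by
  obtain ⟨m, rfl⟩ := Nat.exists_eq_succ_of_ne_zero hm.ne'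
  have key : ∀ {w : K}, w * τ w + w + a = 0 →
      α (m + 1) * w ^ 2 - (a * τ (α m) + α (m + 2)) * w + a * τ (α (m + 1)) = 0 := by
    intro w hw
    have e1 := prod_pow_apply_of_root h0 h1 hα hw m
    have e2 := prod_pow_apply_of_root h0 h1 hα hw (m + 1)
    rw [Finset.prod_range_succ, e1, hτ, AlgEquiv.one_apply] at e2
    linear_combination e2
  have k1 := key hx
  have k2 := key hy
  have k3 := key hz
  have l1 : α (m + 1) * (x + y) - (a * τ (α m) + α (m + 2)) = 0 :=
    mul_left_cancel₀ (sub_ne_zero.2 hxy) (by linear_combination k1 - k2)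
  have l2 : α (m + 1) * (x + z) - (a * τ (α m) + α (m + 2)) = 0 :=
    mul_left_cancel₀ (sub_ne_zero.2 hxz) (by linear_combination k1 - k3)
  exact mul_left_cancel₀ (sub_ne_zero.2 hyz) (by linear_combination l1 - l2)

theorem succ_fixed_of_eq_zero (h0 : α 0 = 0) (h1 : α 1 = 1)
    (hα : ∀ r, α (r + 2) = -τ (α (r + 1)) - τ a * τ (τ (α r))) (ha : a ≠ 0)
    {m : ℕ} (hm : 0 < m) (hτ : τ ^ m = 1) (hαm : α m = 0) :
    τ (α (m + 1)) = α (m + 1) ∧ -(a * τ (α (m - 1))) = α (m + 1) ∧ α (m + 1) ≠ 0 := by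
  have hl := twisted_rec_left h0 h1 hα
  obtain ⟨m, rfl⟩ := Nat.exists_eq_succ_of_ne_zero hm.ne'
  simp only [Nat.succ_eq_add_one, Nat.add_sub_cancel] at *
  have e1 : α (m + 3) = -α (m + 2) := by rw [hl (m + 1), hαm]; ring
  have e2 : α (m + 3) = -τ (α (m + 2)) := by rw [hα (m + 1), hαm]; simp
  have hfix : τ (α (m + 2)) = α (m + 2) := by linear_combination e2 - e1
  have e3 : α (m + 2) = τ (-(a * τ (α m))) := by rw [hα m, hαm]; simp
  refine ⟨hfix, τ.injective (by rw [← e3, hfix]), fun h => ?_⟩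
  have hz : ∀ j ≤ m + 1, α j = 0 ∧ α (j + 1) = 0 := by
    intro j hj
    induction hj using Nat.decreasingInduction with
    | self => exact ⟨hαm, h⟩
    | of_succ j _ ih =>
      refine ⟨?_, ih.1⟩
      have := hl j
      rw [ih.1, ih.2] at this
      have hne : (τ ^ j) a ≠ 0 := (_root_.map_ne_zero _).2 ha
      exact (mul_eq_zero.1 (by linear_combination this : (τ ^ j) a * α j = 0)).resolve_left hne
  exact one_ne_zero (h1.symm.trans (hz 0 (Nat.zero_le _)).2)

/-- Averaging over the cyclic group generated by `τ` turns a solution of the recurrence which is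
`m`-periodic up to the cocycle of `c` into a solution of a twisted linear system. -/
theorem exists_twisted_fixed {m : ℕ} (hm : orderOf τ = m) (hm0 : 0 < m) {c : K} {y : ℕ → K}
    (hy : ∀ i, y (i + 2) = -y (i + 1) - (τ ^ i) a * y i)
    (hc0 : (∏ j ∈ Finset.range m, (τ ^ j) c) * y m = y 0)
    (hc1 : (∏ j ∈ Finset.range m, (τ ^ j) c) * y (m + 1) = y 1)
    (f₁ f₂ : K) (hf : f₁ * y 1 + f₂ * y 0 ≠ 0) :
    ∃ u v : K, τ v = c * u ∧ τ u = c * (-u - a * v) ∧ f₁ * u + f₂ * v ≠ 0 := by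
  set C : ℕ → K := fun i => ∏ j ∈ Finset.range i, (τ ^ j) c with hC
  have hτm : τ ^ m = 1 := hm ▸ pow_orderOf_eq_one τ
  have hinv : ∀ (i : ℕ) (z : K), (τ⁻¹ ^ i) ((τ ^ i) z) = z := fun i z => by
    rw [← AlgEquiv.mul_apply, inv_pow, inv_mul_cancel, AlgEquiv.one_apply]
  have hstep : ∀ (i : ℕ) (z : K), τ ((τ⁻¹ ^ (i + 1)) z) = (τ⁻¹ ^ i) z := fun i z => by
    rw [pow_succ', ← AlgEquiv.mul_apply]; simp
  have hCs : ∀ i, C (i + 1) = C i * (τ ^ i) c := fun i => Finset.prod_range_succ _ _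
  have shift : ∀ (z : ℕ → K), z m = z 0 →
      τ (∑ i ∈ Finset.range m, (τ⁻¹ ^ i) (z i)) = ∑ i ∈ Finset.range m, (τ⁻¹ ^ i) (z (i + 1)) := by
    intro z hz
    have e : ∑ i ∈ Finset.range m, (τ⁻¹ ^ i) (z i)
        = ∑ i ∈ Finset.range m, (τ⁻¹ ^ (i + 1)) (z (i + 1)) := by
      have h1 := Finset.sum_range_succ (fun i => (τ⁻¹ ^ i) (z i)) m
      have h2 := Finset.sum_range_succ' (fun i => (τ⁻¹ ^ i) (z i)) m
      rw [h2] at h1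
      simp only [inv_pow, hτm, hz] at h1 ⊢
      simpa using h1.symm
    rw [e, map_sum]
    exact Finset.sum_congr rfl fun i _ => hstep i _
  have hne : ∃ e : K, ∑ i ∈ Finset.range m, (τ⁻¹ ^ i) e *
      (τ⁻¹ ^ i) (C i) * (f₁ * (τ⁻¹ ^ i) (y (i + 1)) + f₂ * (τ⁻¹ ^ i) (y i)) ≠ 0 := by
    by_contra! hcon
    have hli := linearIndependent_monoidHom K K
    have hinj : Function.Injective
        (fun i : Fin m => ((τ⁻¹ ^ (i : ℕ) : K ≃ₐ[F] K) : K →* K)) := by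
      intro i j hij
      have : (τ⁻¹ ^ (i : ℕ) : K ≃ₐ[F] K) = τ⁻¹ ^ (j : ℕ) :=
        AlgEquiv.ext fun x => DFunLike.congr_fun hij x
      exact Fin.ext (pow_injOn_Iio_orderOf (by simp [hm]) (by simp [hm]) this)
    have := Fintype.linearIndependent_iff.1 (hli.comp _ hinj)
      (fun i => (τ⁻¹ ^ (i : ℕ)) (C i) *
        (f₁ * (τ⁻¹ ^ (i : ℕ)) (y (i + 1)) + f₂ * (τ⁻¹ ^ (i : ℕ)) (y i)))
      (by
        ext e
        simp only [Finset.sum_apply, Pi.smul_apply, Function.comp, smul_eq_mul, Pi.zero_apply]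
        rw [← hcon e, Finset.sum_range]
        refine Finset.sum_congr rfl fun i _ => ?_
        simp only [MonoidHom.coe_coe]
        ring) ⟨0, hm0⟩
    simp [hC] at this
    exact hf this
  obtain ⟨e, he⟩ := hne
  have hpull : ∀ z : ℕ → K, ∑ i ∈ Finset.range m, (τ⁻¹ ^ i) (e * C (i + 1) * z i)
      = c * ∑ i ∈ Finset.range m, (τ⁻¹ ^ i) (e * C i * z i) := by
    intro z
    rw [Finset.mul_sum]
    refine Finset.sum_congr rfl fun i _ => ?_
    rw [hCs]
    simp only [map_mul, hinv]
    ring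
  have hC0 : C 0 = 1 := by simp [hC]
  refine ⟨∑ i ∈ Finset.range m, (τ⁻¹ ^ i) (e * C i * y (i + 1)),
    ∑ i ∈ Finset.range m, (τ⁻¹ ^ i) (e * C i * y i), ?_, ?_, ?_⟩
  · rw [shift (fun i => e * C i * y i) (by simp only [mul_assoc, hC0]; rw [hc0]; ring)]
    exact hpull _
  · rw [shift (fun i => e * C i * y (i + 1)) (by simp only [mul_assoc, hC0]; rw [hc1]; ring), hpull]
    congr 1
    rw [Finset.mul_sum, ← Finset.sum_neg_distrib, ← Finset.sum_sub_distrib]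
    refine Finset.sum_congr rfl fun i _ => ?_
    simp only [hy i, map_mul, map_sub, map_neg, hinv]
    ring
  · convert he using 1
    rw [Finset.mul_sum, Finset.mul_sum, ← Finset.sum_add_distrib]
    refine Finset.sum_congr rfl fun i _ => ?_
    simp only [map_mul]
    ring

/-- If `x * τ x + x + a` comes from two independent solutions of the twisted linear system, its
roots are parametrized by the projective line over the fixed field of `τ`. -/
theorem ncard_roots_of_basis (ha : a ≠ 0) {c r₁ r₂ s₁ s₂ : K} (hc : c ≠ 0)
    (hr₂ : τ r₂ = c * r₁) (hr₁ : τ r₁ = c * (-r₁ - a * r₂))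
    (hs₂ : τ s₂ = c * s₁) (hs₁ : τ s₁ = c * (-s₁ - a * s₂))
    (hdet : r₂ * s₁ - r₁ * s₂ ≠ 0) (hfin : {t : K | τ t = t}.Finite) :
    {x : K | x * τ x + x + a = 0}.ncard = {t : K | τ t = t}.ncard + 1 := by
  have root : ∀ {u v : K}, τ v = c * u → τ u = c * (-u - a * v) → v ≠ 0 →
      (u / v) * τ (u / v) + u / v + a = 0 := by
    intro u v hv hu hv0
    have hu0 : u ≠ 0 := by
      rintro rfl
      exact hv0 (τ.injective (by rw [hv]; simp))
    rw [map_div₀, hv, hu]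
    field_simp
    ring
  have nz : ∀ {u v : K}, τ v = c * u → v = 0 → u = 0 := by
    rintro u v hv rfl
    simpa [hc] using hv.symm
  have hr0 : r₂ ≠ 0 := fun h => hdet (by rw [nz hr₂ h, h]; ring)
  have hden : ∀ {t : K}, τ t = t → s₂ + t * r₂ ≠ 0 := by
    intro t ht h
    have h' := nz (u := s₁ + t * r₁) (by rw [map_add, map_mul, hs₂, hr₂, ht]; ring) h
    exact hdet (by linear_combination r₂ * h' - r₁ * h)
  have hset : {x : K | x * τ x + x + a = 0} = insert (r₁ / r₂)
      ((fun t => (s₁ + t * r₁) / (s₂ + t * r₂)) '' {t : K | τ t = t}) := by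
    ext x
    simp only [Set.mem_ofPred_eq, Set.mem_insert_iff, Set.mem_image]
    constructor
    · intro hx
      by_cases hxr : x = r₁ / r₂
      · exact Or.inl hxr
      · have hx0 : x ≠ 0 := by
          rintro rfl
          exact ha (by simpa using hx)
        have hd : x * r₂ - r₁ ≠ 0 := fun h => hxr (by rw [eq_div_iff hr0]; linear_combination h)
        have hτx : τ x = -(x + a) / x := by
          rw [eq_div_iff hx0]; linear_combination hx
        have ht : τ ((s₁ - x * s₂) / (x * r₂ - r₁)) = (s₁ - x * s₂) / (x * r₂ - r₁) := by
          have e1 : τ (s₁ - x * s₂) = c * a / x * (s₁ - x * s₂) := by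
            rw [map_sub, map_mul, hs₁, hs₂, hτx]; field_simp; ring
          have e2 : τ (x * r₂ - r₁) = c * a / x * (x * r₂ - r₁) := by
            rw [map_sub, map_mul, hr₁, hr₂, hτx]; field_simp; ring
          rw [map_div₀, e1, e2, mul_div_mul_left _ _ (div_ne_zero (mul_ne_zero hc ha) hx0)]
        refine Or.inr ⟨_, ht, ?_⟩
        rw [div_eq_iff (hden ht)]
        field_simp
        ring
    · rintro (rfl | ⟨t, ht, rfl⟩)
      · exact root hr₂ hr₁ hr0
      · exact root (by rw [map_add, map_mul, hs₂, hr₂, ht]; ring)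
          (by rw [map_add, map_mul, hs₁, hr₁, ht]; ring) (hden ht)
  rw [hset, Set.ncard_insert_of_notMem _ (hfin.image _), Set.InjOn.ncard_image]
  · intro t ht t' ht' h
    rw [div_eq_div_iff (hden ht) (hden ht')] at h
    have : (t - t') * (r₂ * s₁ - r₁ * s₂) = 0 := by linear_combination -h
    exact sub_eq_zero.1 ((mul_eq_zero.1 this).resolve_right hdet)
  · rintro ⟨t, ht, h⟩
    rw [div_eq_div_iff (hden ht) hr0] at h
    exact hdet (by linear_combination h)

theorem ncard_roots_eq_iff (h0 : α 0 = 0) (h1 : α 1 = 1)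
    (hα : ∀ r, α (r + 2) = -τ (α (r + 1)) - τ a * τ (τ (α r))) (ha : a ≠ 0)
    {m : ℕ} (hm : orderOf τ = m) (hm0 : 0 < m) (hfin : {t : K | τ t = t}.Finite)
    (hN : ∀ s : K, τ s = s → ∃ c : K, ∏ j ∈ Finset.range m, (τ ^ j) c = s) :
    {x : K | x * τ x + x + a = 0}.ncard = {t : K | τ t = t}.ncard + 1 ↔ α m = 0 := by
  have hτm : τ ^ m = 1 := hm ▸ pow_orderOf_eq_one τ
  have hl := twisted_rec_left h0 h1 hα
  constructor
  · intro h
    have h2 : 1 < {t : K | τ t = t}.ncard :=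
      (Set.one_lt_ncard_iff hfin).2 ⟨0, 1, by simp, by simp, zero_ne_one⟩
    obtain ⟨x, y, z, hx, hy, hz, hxy, hxz, hyz⟩ :=
      (Set.two_lt_ncard_iff (Set.finite_of_ncard_pos (by omega))).1
        (by omega : 2 < {x : K | x * τ x + x + a = 0}.ncard)
    exact eq_zero_of_three_roots h0 h1 hα hm0 hτm hxy hxz hyz hx hy hz
  · intro hαm
    obtain ⟨hfix, hβ, hne⟩ := succ_fixed_of_eq_zero h0 h1 hα ha hm0 hτm hαm
    obtain ⟨c, hc⟩ := hN (α (m + 1))⁻¹ (by rw [map_inv₀, hfix])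
    have hc0 : c ≠ 0 := by
      rintro rfl
      exact inv_ne_zero hne (hc.symm.trans
        (Finset.prod_eq_zero (Finset.mem_range.2 hm0) (map_zero _)))
    obtain ⟨β, hβ0, hβs⟩ : ∃ β : ℕ → K, β 0 = 1 ∧ ∀ i, β (i + 1) = -(a * τ (α i)) :=
      ⟨fun i => Nat.casesOn i 1 fun i => -(a * τ (α i)), rfl, fun _ => rfl⟩
    have hβl : ∀ i, β (i + 2) = -β (i + 1) - (τ ^ i) a * β i := by
      rintro (_ | i)
      · simp [hβs, hβ0, h0, h1]
      · have e := congrArg τ (hl i)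
        simp only [map_sub, map_neg, map_mul, ← AlgEquiv.mul_apply τ, ← pow_succ'] at e
        rw [hβs, hβs, hβs, e]
        ring
    have hβm : β m = α (m + 1) := by
      rw [← hβ, ← hβs, Nat.sub_add_cancel hm0]
    obtain ⟨r₁, r₂, hr₂, hr₁, hr⟩ := exists_twisted_fixed hm hm0 hβl
      (by rw [hc, hβm, hβ0, inv_mul_cancel₀ hne]) (by simp [hβs, hαm, h0]) 0 1 (by simp [hβ0])
    replace hr : r₂ ≠ 0 := by simpa using hr
    obtain ⟨s₁, s₂, hs₂, hs₁, hs⟩ := exists_twisted_fixed hm hm0 hl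
      (by simp [hαm, h0]) (by rw [hc, h1, inv_mul_cancel₀ hne]) r₂ (-r₁) (by simpa [h0, h1] using hr)
    exact ncard_roots_of_basis ha hc0 hr₂ hr₁ hs₂ hs₁
      (by rwa [neg_mul, ← sub_eq_add_neg] at hs) hfin

end TwistedRecurrence

section FiniteField

variable {F K : Type*} [Field F] [Field K] [Algebra F K] [FiniteDimensional F K]

theorem card_eq_ncard_fixed_pow (τ : K ≃ₐ[F] K) :
    Nat.card K = {t : K | τ t = t}.ncard ^ orderOf τ := by
  have hE : Nat.card (IntermediateField.fixedField (Subgroup.zpowers τ)) =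
      {t : K | τ t = t}.ncard := by
    rw [← Nat.card_coe_set_eq]
    refine Nat.card_congr (Equiv.subtypeEquivRight fun t => ?_)
    rw [IntermediateField.mem_fixedField_iff]
    exact ⟨fun h => h τ (Subgroup.mem_zpowers τ), fun h f hf =>
      smul_eq_self_of_mem_zpowers (α := K) hf h⟩
  rw [← hE, ← Nat.card_zpowers, ← IntermediateField.finrank_fixedField_eq_card]
  exact Module.natCard_eq_pow_finrank

theorem exists_prod_pow_eq [Finite K] (τ : K ≃ₐ[F] K) {s : K} (hs : τ s = s) :
    ∃ c : K, ∏ j ∈ Finset.range (orderOf τ), (τ ^ j) c = s := by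
  classical
  set E := IntermediateField.fixedField (Subgroup.zpowers τ)
  have hsE : s ∈ E := by
    rw [IntermediateField.mem_fixedField_iff]
    exact fun f hf => smul_eq_self_of_mem_zpowers (α := K) hf hs
  obtain ⟨c, hc⟩ := FiniteField.norm_surjective E K ⟨s, hsE⟩
  refine ⟨c, ?_⟩
  have h := Algebra.norm_eq_prod_automorphisms E c
  rw [hc, ← ((finEquivZPowers (isOfFinOrder_of_finite τ)).trans
    (IntermediateField.subgroupEquivAlgEquiv (Subgroup.zpowers τ)).toEquiv).prod_comp] at h
  rw [Finset.prod_range]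
  exact h.symm

theorem eval_A_map {q : ℕ} {K L : Type} [Field K] [Field L] (f : K →+* L) (b : K) (r : ℕ) :
    (A q L r).eval (f b) = f ((A q K r).eval b) := by
  induction r using A.induct with
  | case1 => simp [A]
  | case2 => simp [A]
  | case3 => simp [A]
  | case4 r ih1 ih2 => simp [A, ih1, ih2]

theorem eval_A_rec {p k : ℕ} (hp : p.Prime) {K : Type} [Field K] (b : K) (r : ℕ) :
    (A (p ^ k) K (r + 2)).eval b = -((A (p ^ k) K (r + 1)).eval b) ^ p ^ k
      - b ^ p ^ k * (((A (p ^ k) K r).eval b) ^ p ^ k) ^ p ^ k := by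
  cases r with
  | zero => simp [A, hp.ne_zero]
  | succ r => simp [A, sq, pow_mul]

end FiniteField

theorem card_eq_iff_eval_A {p k n : ℕ} [Fact p.Prime] (hn : 0 < n) {K : Type} [Field K]
    [Algebra (ZMod p) K] (hK : Nat.card K = p ^ n) {a : K} (ha : a ≠ 0) :
    {x : K | x ^ (p ^ k + 1) + x + a = 0}.ncard = p ^ n.gcd k + 1
      ↔ (A (p ^ k) K (n / n.gcd k)).eval a = 0 := by
  have hp : p.Prime := Fact.out
  have : Finite K := Nat.finite_of_card_ne_zero (by rw [hK]; exact pow_ne_zero _ hp.ne_zero)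
  have : FiniteDimensional (ZMod p) K := Module.Finite.of_finite
  have hrank : Module.finrank (ZMod p) K = n := by
    have h := Module.natCard_eq_pow_finrank (K := ZMod p) (V := K)
    rw [hK, Nat.card_zmod] at h
    exact (Nat.pow_right_injective hp.two_le h).symm
  have hg : 0 < n.gcd k := Nat.gcd_pos_of_pos_left k hn
  have hm0 : 0 < n / n.gcd k := Nat.div_pos (Nat.gcd_le_left k hn) hg
  set τ : K ≃ₐ[ZMod p] K := FiniteField.frobeniusAlgEquivOfAlgebraic (ZMod p) K ^ k with hτ
  have hτa : ∀ x, τ x = x ^ p ^ k := fun x => by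
    simp [hτ, AlgEquiv.coe_pow, FiniteField.coe_frobeniusAlgEquivOfAlgebraic, pow_iterate]
  have hord : orderOf τ = n / n.gcd k := by
    rw [hτ, orderOf_pow, FiniteField.orderOf_frobeniusAlgEquivOfAlgebraic, hrank]
  have hfix : {t : K | τ t = t}.ncard = p ^ n.gcd k := by
    have h := card_eq_ncard_fixed_pow τ
    rw [hord, hK] at h
    refine (Nat.pow_left_injective hm0.ne' ?_).symm
    simp only [← h]
    rw [← pow_mul, Nat.mul_div_cancel' (Nat.gcd_dvd_left n k)]
  rw [← ncard_roots_eq_iff (τ := τ) (a := a) (α := fun r => (A (p ^ k) K r).eval a) (by simp [A])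
    (by simp [A]) (fun r => by simp only [hτa]; exact eval_A_rec hp a r) ha hord hm0
    (Set.toFinite _) (fun s hs => hord ▸ exists_prod_pow_eq τ hs), hfix]
  simp only [hτa, pow_succ']

/-- For nonzero `a ∈ GF(Q)`, the polynomial `P_a(X) = X^{q+1} + X + a` has exactly `p^d + 1`
zeros in `GF(Q)` if and only if `F(a) = A_m(a) = 0`, where `q = p^k`, `Q = p^n`,
`d = gcd(n,k)`, `m = n/d`.  `GF(Q)` is realized inside the algebraic closure as the fixed
points of `x ↦ x^Q`. -/
theorem statement_12 (p k n d m q Q : ℕ) [Fact p.Prime] (hk : 0 < k) (hn : 0 < n)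
    (hd : d = Nat.gcd n k) (hm : m = n / d) (hq : q = p ^ k) (hQ : Q = p ^ n)
    (a : Kbar p) (haQ : a ^ Q = a) (ha0 : a ≠ 0) :
    {x : Kbar p | x ^ Q = x ∧ x ^ (q + 1) + x + a = 0}.ncard = p ^ d + 1
      ↔ (A q (Kbar p) m).eval a = 0 := by
  subst hm hd hq hQ
  classical
  have hp : p.Prime := Fact.out
  let f : GaloisField p n →ₐ[ZMod p] Kbar p := IsAlgClosed.lift
  have hf : Function.Injective f := f.toRingHom.injective
  have hcard := GaloisField.card p n hn.ne'
  have hrange : Set.range f = {x : Kbar p | x ^ p ^ n = x} := by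
    have hQ : 1 < p ^ n := Nat.one_lt_pow hn.ne' hp.one_lt
    have hroots : {x : Kbar p | x ^ p ^ n = x} =
        ((X ^ p ^ n - X : (Kbar p)[X]).roots.toFinset : Set (Kbar p)) := by
      ext x
      simp [FiniteField.X_pow_card_sub_X_ne_zero (Kbar p) hQ, sub_eq_zero]
    refine Set.eq_of_subset_of_ncard_le ?_ ?_ (hroots ▸ Finset.finite_toSet _)
    · rintro _ ⟨x, rfl⟩
      have : Fintype (GaloisField p n) := Fintype.ofFinite _
      have h := FiniteField.pow_card x
      rw [← Nat.card_eq_fintype_card, hcard] at h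
      rw [Set.mem_ofPred_eq, ← map_pow, h]
    · rw [hroots, Set.ncard_coe_finset, ← Set.image_univ, Set.ncard_image_of_injective _ hf,
        Set.ncard_univ, hcard]
      refine (Multiset.toFinset_card_le _).trans ((card_roots' _).trans ?_)
      rw [FiniteField.X_pow_card_sub_X_natDegree_eq (Kbar p) hQ]
  obtain ⟨b, rfl⟩ : a ∈ Set.range f := hrange ▸ haQ
  have hset : {x : Kbar p | x ^ p ^ n = x ∧ x ^ (p ^ k + 1) + x + f b = 0} =
      f '' {x | x ^ (p ^ k + 1) + x + b = 0} := by
    ext x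
    have hmem : x ^ p ^ n = x ↔ x ∈ Set.range f := by rw [hrange]; rfl
    simp only [Set.mem_ofPred_eq, hmem, Set.mem_image]
    constructor
    · rintro ⟨⟨y, rfl⟩, hy⟩
      exact ⟨y, hf (by simpa using hy), rfl⟩
    · rintro ⟨y, hy, rfl⟩
      exact ⟨⟨y, rfl⟩, by simpa using congrArg f hy⟩
  rw [hset, Set.ncard_image_of_injective _ hf,
    card_eq_iff_eval_A hn hcard (by rintro rfl; simp at ha0)]
  have hA : (A (p ^ k) (Kbar p) (n / n.gcd k)).eval (f b) =
      f ((A (p ^ k) (GaloisField p n) (n / n.gcd k)).eval b) := eval_A_map f.toRingHom b _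
  rw [hA, map_eq_zero_iff f hf]
end

section
/- Let a ∈ GF(Q) be nonzero. Then the polynomial P_a(X) = X^{q+1} + X + a has exactly p^d + 1 zeros in GF(Q) if and only if there exists u ∈ GF(Q) \ GF(p^{2d}) such that a = (u - u^q)^{q^2+1} / (u - u^{q^2})^{q+1}. -/
section SemilinearQuadratic

variable {L : Type*} [Field L]

/-- The zeros of `x * σ x + x + a` in a subfield `F`. -/
def twistedZeros (σ : L →+* L) (F : Subfield L) (a : L) : Set L :=
  {x | x ∈ F ∧ x * σ x + x + a = 0}

/-- The parametrization of the coefficients `a` for which `x * σ x + x + a` has more than two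
zeros. -/
def twistedParam (σ : L →+* L) (u : L) : L :=
  σ (σ (u - σ u)) * (u - σ u) / (σ (u - σ (σ u)) * (u - σ (σ u)))

theorem map_ne_self_of_map_map_ne_self {σ : L →+* L} {u : L} (hu : σ (σ u) ≠ u) : σ u ≠ u := by
  intro h
  exact hu (by rw [h, h])

theorem map_sub_ne_zero_of_map_eq_self {σ : L →+* L} {u c : L} (hu : σ u ≠ u) (hc : σ c = c) :
    σ u - c ≠ 0 := by
  intro h
  apply hu
  apply σ.injective
  rw [sub_eq_zero.1 h, hc]

theorem map_twistedParam (σ : L →+* L) (u : L) :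
    σ (twistedParam σ u) = twistedParam σ (σ u) := by
  simp [twistedParam]

/-- The zeros of `x * σ x + x + twistedParam σ u` form a projective line over the fixed field. -/
theorem twistedZeros_twistedParam {σ : L →+* L} {F : Subfield L} (hσF : ∀ x ∈ F, σ x ∈ F)
    {u : L} (huF : u ∈ F) (hu : σ (σ u) ≠ u) :
    twistedZeros σ F (twistedParam σ u) =
      insert (-(u - σ u) / (u - σ (σ u)))
        ((fun c => -(u - σ u) / (u - σ (σ u)) * ((σ (σ u) - c) / (σ u - c))) ''
          {c | c ∈ F ∧ σ c = c}) := by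
  have hu1 := map_ne_self_of_map_map_ne_self hu
  have hD : u - σ (σ u) ≠ 0 := sub_ne_zero.2 hu.symm
  have hD' : σ u - σ (σ (σ u)) ≠ 0 := by
    simpa only [map_sub] using (map_ne_zero σ).2 hD
  have hd : u - σ u ≠ 0 := sub_ne_zero.2 hu1.symm
  have hd' : σ u - σ (σ u) ≠ 0 := by simpa only [map_sub] using (map_ne_zero σ).2 hd
  have h1F := hσF u huF
  have h2F := hσF _ h1F
  have hx0F : -(u - σ u) / (u - σ (σ u)) ∈ F :=
    F.div_mem (F.neg_mem (F.sub_mem huF h1F)) (F.sub_mem huF h2F)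
  ext x
  simp only [twistedZeros, twistedParam, Set.mem_ofPred_eq, Set.mem_insert_iff, Set.mem_image]
  constructor
  · rintro ⟨hxF, hx⟩
    by_cases hx0 : x = -(u - σ u) / (u - σ (σ u))
    · exact Or.inl hx0
    right
    have hxD : x * (u - σ (σ u)) + (u - σ u) ≠ 0 := by
      intro h
      apply hx0
      rw [eq_div_iff hD]
      linear_combination h
    have hxD' : σ x * (σ u - σ (σ (σ u))) + (σ u - σ (σ u)) ≠ 0 := by
      simpa only [map_sub, map_add, map_mul] using (map_ne_zero σ).2 hxD
    refine ⟨σ u - (u - σ u) * (σ u - σ (σ u)) / (x * (u - σ (σ u)) + (u - σ u)), ⟨?_, ?_⟩, ?_⟩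
    · exact F.sub_mem h1F (F.div_mem (F.mul_mem (F.sub_mem huF h1F) (F.sub_mem h1F h2F))
        (F.add_mem (F.mul_mem hxF (F.sub_mem huF h2F)) (F.sub_mem huF h1F)))
    · simp only [map_sub, map_add, map_mul, map_div₀] at hx ⊢
      field_simp at hx ⊢
      linear_combination (-(σ u - σ (σ u))) * hx
    · have hc : σ u - (σ u - (u - σ u) * (σ u - σ (σ u)) / (x * (u - σ (σ u)) + (u - σ u))) ≠ 0 := by
        rw [sub_sub_cancel]
        exact div_ne_zero (mul_ne_zero hd hd') hxD
      rw [div_mul_div_comm, div_eq_iff (mul_ne_zero hD hc)]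
      field_simp
      ring
  · rintro (rfl | ⟨c, ⟨hcF, hc⟩, rfl⟩)
    · refine ⟨hx0F, ?_⟩
      simp only [map_sub, map_neg, map_div₀]
      field_simp
      ring
    · have h1 := map_sub_ne_zero_of_map_eq_self hu1 hc
      have h2 : σ (σ u) - c ≠ 0 := by
        simpa only [map_sub, hc] using (map_ne_zero σ).2 h1
      refine ⟨F.mul_mem hx0F (F.div_mem (F.sub_mem h2F hcF) (F.sub_mem h1F hcF)), ?_⟩
      simp only [map_sub, map_neg, map_div₀, map_mul, hc]
      field_simp
      ring

theorem ncard_twistedZeros_twistedParam {σ : L →+* L} {F : Subfield L}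
    (hσF : ∀ x ∈ F, σ x ∈ F) (hK : {c | c ∈ F ∧ σ c = c}.Finite)
    {u : L} (huF : u ∈ F) (hu : σ (σ u) ≠ u) :
    (twistedZeros σ F (twistedParam σ u)).ncard = {c | c ∈ F ∧ σ c = c}.ncard + 1 := by
  have hu1 := map_ne_self_of_map_map_ne_self hu
  have hu12 : σ (σ u) - σ u ≠ 0 := sub_ne_zero.2 fun h => hu1 (σ.injective h)
  have hx0 : -(u - σ u) / (u - σ (σ u)) ≠ 0 :=
    div_ne_zero (neg_ne_zero.2 (sub_ne_zero.2 hu1.symm)) (sub_ne_zero.2 hu.symm)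
  rw [twistedZeros_twistedParam hσF huF hu, Set.ncard_insert_of_notMem _ (hK.image _),
    Set.InjOn.ncard_image]
  · rintro c ⟨-, hc⟩ e ⟨-, he⟩ h
    have h' := mul_left_cancel₀ hx0 h
    rw [div_eq_div_iff (map_sub_ne_zero_of_map_eq_self hu1 hc)
      (map_sub_ne_zero_of_map_eq_self hu1 he)] at h'
    have : (σ (σ u) - σ u) * (c - e) = 0 := by linear_combination h'
    exact sub_eq_zero.1 ((mul_eq_zero.1 this).resolve_left hu12)
  · rintro ⟨c, ⟨-, hc⟩, h⟩
    have h' := (mul_eq_left₀ hx0).1 h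
    rw [div_eq_one_iff_eq (map_sub_ne_zero_of_map_eq_self hu1 hc)] at h'
    exact hu12 (by linear_combination h')

/-- If `x * σ x + x + a` has three distinct zeros, then `σ a` is in the range of the
parametrization. -/
theorem exists_map_eq_twistedParam {σ : L →+* L} {F : Subfield L} {a x y z : L} (ha : a ≠ 0)
    (hx : x ∈ twistedZeros σ F a) (hy : y ∈ twistedZeros σ F a) (hz : z ∈ twistedZeros σ F a)
    (hxy : x ≠ y) (hxz : x ≠ z) (hyz : y ≠ z) :
    ∃ v ∈ F, σ (σ v) ≠ v ∧ σ a = twistedParam σ v := by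
  obtain ⟨hxF, hx⟩ := hx
  obtain ⟨hyF, hy⟩ := hy
  obtain ⟨hzF, hz⟩ := hz
  have hx0 : x ≠ 0 := by
    rintro rfl
    simp [ha] at hx
  have hy1 : y - x ≠ 0 := sub_ne_zero.2 hxy.symm
  have hz1 : z - x ≠ 0 := sub_ne_zero.2 hxz.symm
  have hzy : z - y ≠ 0 := sub_ne_zero.2 hyz.symm
  have hσzy : σ z - σ y ≠ 0 := by simpa only [map_sub] using (map_ne_zero σ).2 hzy
  set v := (z - x) / (z - y) with hv
  have hvF : v ∈ F := F.div_mem (F.sub_mem hzF hxF) (F.sub_mem hzF hyF)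
  have hδ : x * (v - σ v) * (z - y) = -((y - x) * (z - x)) := by
    have h : (v - σ v) * (z - y) * (σ z - σ y) =
        (σ z - σ x) * (y - x) - (z - x) * (σ y - σ x) := by
      simp only [hv, map_sub, map_div₀]
      field_simp
      ring
    apply mul_right_cancel₀ hσzy
    linear_combination x * h + (y - x) * (hz - hx) - (z - x) * (hy - hx)
  have hδ0 : v - σ v ≠ 0 := by
    intro h
    rw [h] at hδ
    simp [hy1, hz1] at hδ
  have hΔ : σ x * (v - σ (σ v)) = -(v - σ v) := by
    have hσδ := congrArg σ hδ
    simp only [map_mul, map_sub, map_neg] at hσδ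
    have h : (σ x + 1) * (v - σ v) * (σ z - σ y) = (σ y - σ x) * (σ z - σ x) := by
      apply mul_left_cancel₀ (mul_ne_zero hx0 hzy)
      linear_combination (σ x + 1) * (σ z - σ y) * hδ
        - (z - x) * (σ z - σ x) * (hy - hx) + (y - x) * (σ y - σ x) * (hz - hx)
    apply mul_right_cancel₀ hσzy
    linear_combination h + hσδ
  have hΔ0 : v - σ (σ v) ≠ 0 := by
    intro h
    rw [h, mul_zero] at hΔ
    exact hδ0 (neg_eq_zero.1 hΔ.symm)
  refine ⟨v, hvF, fun h => hΔ0 (sub_eq_zero.2 h.symm), ?_⟩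
  have hσx' : σ x = -(v - σ v) / (v - σ (σ v)) := (eq_div_iff hΔ0).2 hΔ
  have hσa : σ a = -(σ x * (σ (σ x) + 1)) := by
    have := congrArg σ hx
    simp only [map_add, map_mul, map_zero] at this
    linear_combination this
  have hΔ' : σ v - σ (σ (σ v)) ≠ 0 := by simpa only [map_sub] using (map_ne_zero σ).2 hΔ0
  rw [hσa, hσx', twistedParam]
  simp only [map_sub, map_neg, map_div₀]
  field_simp
  ring

theorem ncard_twistedZeros_eq_iff {σ : L →+* L} {F : Subfield L} (hσF : ∀ x ∈ F, σ x ∈ F)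
    (hsurj : ∀ y ∈ F, ∃ x ∈ F, σ x = y) (hK : 2 ≤ {c | c ∈ F ∧ σ c = c}.ncard)
    {a : L} (ha : a ≠ 0) :
    (twistedZeros σ F a).ncard = {c | c ∈ F ∧ σ c = c}.ncard + 1 ↔
      ∃ u ∈ F, σ (σ u) ≠ u ∧ a = twistedParam σ u := by
  constructor
  · intro h
    have h3 : 2 < (twistedZeros σ F a).ncard := by omega
    obtain ⟨x, y, z, hx, hy, hz, hxy, hxz, hyz⟩ :=
      (Set.two_lt_ncard_iff (Set.finite_of_ncard_pos (by omega))).1 h3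
    obtain ⟨v, hvF, hv, hav⟩ := exists_map_eq_twistedParam ha hx hy hz hxy hxz hyz
    obtain ⟨u, huF, rfl⟩ := hsurj v hvF
    exact ⟨u, huF, fun h => hv (congrArg σ h), σ.injective (hav.trans (map_twistedParam σ u).symm)⟩
  · rintro ⟨u, huF, hu, rfl⟩
    exact ncard_twistedZeros_twistedParam hσF (Set.finite_of_ncard_pos (by omega)) huF hu

end SemilinearQuadratic

section Frobenius

variable {L : Type*} [Field L] (p : ℕ) [Fact p.Prime] [CharP L p]

theorem pow_prime_pow_gcd_eq_self_iff (m n : ℕ) (x : L) :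
    x ^ p ^ Nat.gcd m n = x ↔ x ^ p ^ m = x ∧ x ^ p ^ n = x := by
  have key : ∀ r, x ^ p ^ r = x ↔ Function.IsPeriodicPt (frobenius L p) r x := by
    intro r
    rw [Function.IsPeriodicPt, Function.IsFixedPt, iterate_frobenius]
  simp only [key]
  exact ⟨fun h => ⟨h.trans_dvd (Nat.gcd_dvd_left m n), h.trans_dvd (Nat.gcd_dvd_right m n)⟩,
    fun h => h.1.gcd h.2⟩

theorem ncard_pow_prime_pow_eq_self [IsAlgClosed L] {d : ℕ} (hd : d ≠ 0) :
    {x : L | x ^ p ^ d = x}.ncard = p ^ d := by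
  have hp1 : 1 < p ^ d := Nat.one_lt_pow hd (Fact.out : p.Prime).one_lt
  have hsep : (Polynomial.X ^ p ^ d - Polynomial.X : Polynomial L).Separable :=
    galois_poly_separable p _ (dvd_pow_self p hd)
  have hcard := Polynomial.card_rootSet_eq_natDegree (K := L) hsep (IsAlgClosed.splits _)
  rw [FiniteField.X_pow_card_sub_X_natDegree_eq L hp1] at hcard
  rw [← Nat.card_eq_fintype_card] at hcard
  refine Eq.trans ?_ hcard
  rw [Nat.card_coe_set_eq]
  congr 1
  ext x
  rw [Polynomial.mem_rootSet_of_ne (FiniteField.X_pow_card_sub_X_ne_zero L hp1)]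
  simp [sub_eq_zero]

end Frobenius

/-- For nonzero `a ∈ GF(Q)`, the polynomial `P_a(X) = X^{q+1} + X + a` has exactly `p^d + 1`
zeros in `GF(Q)` if and only if there exists `u ∈ GF(Q) \ GF(p^{2d})` with
`a = (u - u^q)^{q²+1}/(u - u^{q²})^{q+1}`, where `q = p^k`, `Q = p^n`, `d = gcd(n,k)`.
`GF(p^s)` is realized inside the algebraic closure as the fixed points of `x ↦ x^{p^s}`. -/
theorem statement_13 (p k n d q Q : ℕ) [Fact p.Prime] (hk : 0 < k) (hn : 0 < n)
    (hd : d = Nat.gcd n k) (hq : q = p ^ k) (hQ : Q = p ^ n)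
    (a : AlgebraicClosure (ZMod p)) (haQ : a ^ Q = a) (ha0 : a ≠ 0) :
    {x : AlgebraicClosure (ZMod p) | x ^ Q = x ∧ x ^ (q + 1) + x + a = 0}.ncard = p ^ d + 1
      ↔ ∃ u : AlgebraicClosure (ZMod p), u ^ Q = u ∧ ¬ u ^ p ^ (2 * d) = u ∧
          a = (u - u ^ q) ^ (q ^ 2 + 1) / (u - u ^ q ^ 2) ^ (q + 1) := by
  have hd0 : d ≠ 0 := hd ▸ (Nat.gcd_pos_of_pos_left k hn).ne'
  let L := AlgebraicClosure (ZMod p)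
  set σ := iterateFrobenius L p k with hσ
  set F := (iterateFrobenius L p n).eqLocusField (RingHom.id L) with hF
  have hσx : ∀ x, σ x = x ^ q := fun x => by rw [hσ, iterateFrobenius_def, hq]
  have hmem : ∀ x, x ∈ F ↔ x ^ Q = x := fun x => by
    rw [hF, RingHom.mem_eqLocusField, iterateFrobenius_def, hQ, RingHom.id_apply]
  have hσF : ∀ x ∈ F, σ x ∈ F := fun x hx => by
    rw [hmem] at hx ⊢
    rw [hσx, pow_right_comm, hx]
  have hsurj : ∀ y ∈ F, ∃ x ∈ F, σ x = y := by
    intro y hy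
    rw [hmem, hQ] at hy
    refine ⟨y ^ p ^ (n * k - k), ?_, ?_⟩
    · rw [hmem, hQ, pow_right_comm, hy]
    · rw [hσx, hq, ← pow_mul, ← pow_add, Nat.sub_add_cancel (Nat.le_mul_of_pos_left k hn)]
      exact ((pow_prime_pow_gcd_eq_self_iff p n (n * k) y).1
        (by rwa [Nat.gcd_eq_left (Nat.dvd_mul_right n k)])).2
  have hK : {c | c ∈ F ∧ σ c = c}.ncard = p ^ d := by
    rw [← ncard_pow_prime_pow_eq_self (L := L) p hd0]
    congr 1
    ext c
    simp only [Set.mem_ofPred_eq, hmem, hσx, hd, hq, hQ, pow_prime_pow_gcd_eq_self_iff]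
  have hK2 : 2 ≤ {c | c ∈ F ∧ σ c = c}.ncard :=
    hK ▸ Nat.one_lt_pow hd0 (Fact.out : p.Prime).one_lt
  have hZ : {x : L | x ^ Q = x ∧ x ^ (q + 1) + x + a = 0} = twistedZeros σ F a := by
    ext x
    simp only [twistedZeros, Set.mem_ofPred_eq, hmem, hσx, pow_succ' x q]
  rw [hZ, ← hK, ncard_twistedZeros_eq_iff hσF hsurj hK2 ha0]
  refine exists_congr fun u => ?_
  rw [hmem]
  refine and_congr_right fun hu => and_congr ?_ ?_
  · rw [not_iff_not, hσx, hσx, ← pow_mul, hq, ← pow_add, ← two_mul]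
    rw [hQ] at hu
    constructor
    · intro h
      have hg : Nat.gcd n (2 * k) ∣ 2 * d := by
        rw [hd, ← Nat.gcd_mul_left]
        exact Nat.gcd_dvd_gcd_of_dvd_left _ (Nat.dvd_mul_left n 2)
      have h' := (pow_prime_pow_gcd_eq_self_iff p n (2 * k) u).2 ⟨hu, h⟩
      rw [← Nat.gcd_eq_left hg] at h'
      exact ((pow_prime_pow_gcd_eq_self_iff p _ _ u).1 h').2
    · intro h
      have hg : 2 * d ∣ 2 * k := Nat.mul_dvd_mul_left 2 (hd ▸ Nat.gcd_dvd_right n k)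
      rw [← Nat.gcd_eq_left hg] at h
      exact ((pow_prime_pow_gcd_eq_self_iff p _ _ u).1 h).2
  · simp only [twistedParam, hσx, ← pow_mul, ← sq, pow_succ _ (q ^ 2), pow_succ _ q]
end

section
/- Let u ∈ GF(Q) \ GF(p^{2d}) and set a = (u - u^q)^{q^2+1} / (u - u^{q^2})^{q+1}. Then 1 + (u - u^q)^{q-1} ≠ 0, and the set of zeros of P_a(X) = X^{q+1} + X + a in GF(Q) is exactly { -1/(1 + (u-u^q)^{q-1}) } ∪ { -(u+α)^{q^2-q}/(1 + (u-u^q)^{q-1}) : α ∈ GF(p^d) }, a set of cardinality p^d + 1. -/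
section PeriodicPoints

variable {K : Type*} [Field K] {p : ℕ} [Fact p.Prime] [CharP K p]

lemma isPeriodicPt_frobenius_iff (n : ℕ) (x : K) :
    Function.IsPeriodicPt (frobenius K p) n x ↔ x ^ p ^ n = x := by
  rw [Function.IsPeriodicPt, Function.IsFixedPt, iterate_frobenius]

lemma pow_pow_eq_self_of_dvd {m n : ℕ} (h : m ∣ n) {x : K} (hx : x ^ p ^ m = x) :
    x ^ p ^ n = x := by
  rw [← isPeriodicPt_frobenius_iff] at hx ⊢
  exact hx.trans_dvd h

lemma pow_pow_gcd_eq_self {m n : ℕ} {x : K} (hm : x ^ p ^ m = x) (hn : x ^ p ^ n = x) :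
    x ^ p ^ m.gcd n = x := by
  rw [← isPeriodicPt_frobenius_iff] at hm hn ⊢
  exact hm.gcd hn

lemma ncard_pow_pow_eq_self [IsAlgClosed K] {d : ℕ} (hd : d ≠ 0) :
    {x : K | x ^ p ^ d = x}.ncard = p ^ d := by
  classical
  have hp := (Fact.out : p.Prime)
  have hne : (Polynomial.X ^ p ^ d - Polynomial.X : Polynomial K) ≠ 0 :=
    FiniteField.X_pow_card_pow_sub_X_ne_zero K hd hp.one_lt
  have hset : {x : K | x ^ p ^ d = x} =
      (Polynomial.X ^ p ^ d - Polynomial.X : Polynomial K).rootSet K := by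
    ext x
    rw [Polynomial.mem_rootSet_of_ne hne]
    simp [sub_eq_zero]
  rw [hset, ← Nat.card_coe_set_eq, Nat.card_eq_fintype_card,
    Polynomial.card_rootSet_eq_natDegree
      (galois_poly_separable p (p ^ d) (dvd_pow_self p hd)) (IsAlgClosed.splits _),
    FiniteField.X_pow_card_pow_sub_X_natDegree_eq K hd hp.one_lt]

end PeriodicPoints

section TwistedQuadratic

variable {K : Type*} [Field K] (σ : K →+* K) {u : K}

lemma twisted_root_base (hw : u - σ (σ u) ≠ 0) :
    σ (-((u - σ u) / (u - σ (σ u)))) * -((u - σ u) / (u - σ (σ u))) +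
      -((u - σ u) / (u - σ (σ u))) +
      σ (σ (u - σ u)) * (u - σ u) / (σ (u - σ (σ u)) * (u - σ (σ u))) = 0 := by
  have hw' : σ u - σ (σ (σ u)) ≠ 0 := by simpa using (map_ne_zero σ).2 hw
  simp only [map_neg, map_div₀, map_sub]
  field_simp
  ring

lemma twisted_root_param (hw : u - σ (σ u) ≠ 0) {t : K} (ht : t ≠ 0)
    (h : t - σ t = u - σ u) :
    σ (-(σ (σ t) / σ t * ((u - σ u) / (u - σ (σ u))))) *
        -(σ (σ t) / σ t * ((u - σ u) / (u - σ (σ u)))) +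
      -(σ (σ t) / σ t * ((u - σ u) / (u - σ (σ u)))) +
      σ (σ (u - σ u)) * (u - σ u) / (σ (u - σ (σ u)) * (u - σ (σ u))) = 0 := by
  have hu : u - σ (σ u) = t - σ (σ t) := by
    have h' : σ t - σ (σ t) = σ u - σ (σ u) := by simpa using congrArg σ h
    linear_combination -h - h'
  rw [hu] at hw ⊢
  rw [← h]
  have hw' : σ t - σ (σ (σ t)) ≠ 0 := by simpa using (map_ne_zero σ).2 hw
  have ht1 : σ t ≠ 0 := (map_ne_zero σ).2 ht
  have ht2 : σ (σ t) ≠ 0 := (map_ne_zero σ).2 ht1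
  simp only [map_neg, map_div₀, map_sub, map_mul]
  field_simp
  ring

/-- In the coordinate `1 / (x - x₀)` centred at the root `x₀`, the equation becomes affine. -/
lemma twisted_root_translate (hv : u - σ u ≠ 0) (hw : u - σ (σ u) ≠ 0) {x : K}
    (hx : σ x * x + x +
      σ (σ (u - σ u)) * (u - σ u) / (σ (u - σ (σ u)) * (u - σ (σ u))) = 0)
    (hne : x ≠ -((u - σ u) / (u - σ (σ u)))) :
    σ ((u - σ u) * σ (u - σ u) /
        ((u - σ (σ u)) * (x + (u - σ u) / (u - σ (σ u)))) - σ u) =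
      (u - σ u) * σ (u - σ u) /
        ((u - σ (σ u)) * (x + (u - σ u) / (u - σ (σ u)))) - σ u := by
  obtain ⟨y, rfl⟩ : ∃ y, x = y - (u - σ u) / (u - σ (σ u)) :=
    ⟨x + (u - σ u) / (u - σ (σ u)), by ring⟩
  have hy : y ≠ 0 := by
    rintro rfl
    simp at hne
  have hy' : σ y ≠ 0 := (map_ne_zero σ).2 hy
  have hv' : σ u - σ (σ u) ≠ 0 := by simpa using (map_ne_zero σ).2 hv
  have hw' : σ u - σ (σ (σ u)) ≠ 0 := by simpa using (map_ne_zero σ).2 hw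
  rw [sub_add_cancel]
  simp only [map_div₀, map_sub, map_mul] at hx ⊢
  field_simp at hx ⊢
  linear_combination (σ u - σ (σ u)) * hx

lemma twisted_param_sub_base (hw : u - σ (σ u) ≠ 0) {t : K} (ht : t ≠ 0)
    (h : t - σ t = u - σ u) :
    -(σ (σ t) / σ t * ((u - σ u) / (u - σ (σ u)))) + (u - σ u) / (u - σ (σ u)) =
      (u - σ u) * σ (u - σ u) / ((u - σ (σ u)) * σ t) := by
  have h' : σ t - σ (σ t) = σ u - σ (σ u) := by simpa using congrArg σ h
  have ht1 : σ t ≠ 0 := (map_ne_zero σ).2 ht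
  rw [map_sub, ← h']
  field_simp
  ring

end TwistedQuadratic


/-- Let `u ∈ GF(Q) \ GF(p^{2d})` and `a = (u - u^q)^{q²+1}/(u - u^{q²})^{q+1}`. Then
`1 + (u - u^q)^{q-1} ≠ 0`, the set of zeros of `P_a(X) = X^{q+1} + X + a` in `GF(Q)` is
exactly `{-1/(1+(u-u^q)^{q-1})} ∪ {-(u+α)^{q²-q}/(1+(u-u^q)^{q-1}) : α ∈ GF(p^d)}`, and this
set has cardinality `p^d + 1`.  Here `q = p^k`, `Q = p^n`, `d = gcd(n,k)`, and `GF(p^s)` is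
realized inside the algebraic closure as the fixed points of `x ↦ x^{p^s}`. -/
theorem statement_14 (p k n d q Q : ℕ) [Fact p.Prime] (hk : 0 < k) (hn : 0 < n)
    (hd : d = Nat.gcd n k) (hq : q = p ^ k) (hQ : Q = p ^ n)
    (u : AlgebraicClosure (ZMod p)) (huQ : u ^ Q = u) (hu2 : ¬ u ^ p ^ (2 * d) = u)
    (a : AlgebraicClosure (ZMod p))
    (ha : a = (u - u ^ q) ^ (q ^ 2 + 1) / (u - u ^ q ^ 2) ^ (q + 1)) :
    1 + (u - u ^ q) ^ (q - 1) ≠ 0 ∧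
    {x : AlgebraicClosure (ZMod p) | x ^ Q = x ∧ x ^ (q + 1) + x + a = 0}
      = ({-1 / (1 + (u - u ^ q) ^ (q - 1))} ∪
          {x : AlgebraicClosure (ZMod p) | ∃ α : AlgebraicClosure (ZMod p),
            α ^ p ^ d = α ∧ x = -(u + α) ^ (q ^ 2 - q) / (1 + (u - u ^ q) ^ (q - 1))}) ∧
    ({-1 / (1 + (u - u ^ q) ^ (q - 1))} ∪
        {x : AlgebraicClosure (ZMod p) | ∃ α : AlgebraicClosure (ZMod p),
          α ^ p ^ d = α ∧ x = -(u + α) ^ (q ^ 2 - q) / (1 + (u - u ^ q) ^ (q - 1))}).ncard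
      = p ^ d + 1 := by
  have hpp := (Fact.out : p.Prime)
  have hd0 : d ≠ 0 := hd ▸ (Nat.gcd_pos_of_pos_left k hn).ne'
  have hdn : d ∣ n := hd ▸ Nat.gcd_dvd_left n k
  have hdk : d ∣ k := hd ▸ Nat.gcd_dvd_right n k
  have hq0 : 0 < q := hq ▸ pow_pos hpp.pos k
  let σ : AlgebraicClosure (ZMod p) →+* AlgebraicClosure (ZMod p) :=
    iterateFrobenius (AlgebraicClosure (ZMod p)) p k
  let τ : AlgebraicClosure (ZMod p) →+* AlgebraicClosure (ZMod p) :=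
    iterateFrobenius (AlgebraicClosure (ZMod p)) p n
  have hσ (x : AlgebraicClosure (ZMod p)) : x ^ q = σ x := by rw [hq]; rfl
  have hτ (x : AlgebraicClosure (ZMod p)) : x ^ Q = τ x := by rw [hQ]; rfl
  have hσσ (x : AlgebraicClosure (ZMod p)) : x ^ q ^ 2 = σ (σ x) := by rw [sq, pow_mul, hσ, hσ]
  have hcomm (x : AlgebraicClosure (ZMod p)) : τ (σ x) = σ (τ x) := by
    rw [← hτ, ← hτ, map_pow]
  have hw : u - σ (σ u) ≠ 0 := by
    intro h
    have h1 : u ^ p ^ (k * 2) = u := by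
      rw [pow_mul, ← hq, hσσ]
      exact (sub_eq_zero.1 h).symm
    refine hu2 (pow_pow_eq_self_of_dvd ?_ (pow_pow_gcd_eq_self (hQ ▸ huQ) h1))
    rw [hd, mul_comm 2]
    exact (Nat.gcd_dvd_gcd_mul_right_left n (k * 2) 2).trans (Nat.gcd_mul_right n 2 k).dvd
  have hv : u - σ u ≠ 0 := by
    intro h
    have h1 : σ u = u := (sub_eq_zero.1 h).symm
    exact hw (by rw [h1, h1, sub_self])
  have hv' : σ (u - σ u) ≠ 0 := (map_ne_zero σ).2 hv
  have hD : 1 + (u - u ^ q) ^ (q - 1) = (u - σ (σ u)) / (u - σ u) := by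
    rw [hσ u, pow_sub₀ _ hv hq0, hσ, pow_one, map_sub]
    field_simp
    ring
  have hfix {α : AlgebraicClosure (ZMod p)} (hα : α ^ p ^ d = α) : σ α = α ∧ τ α = α := by
    rw [← hσ, ← hτ, hq, hQ]
    exact ⟨pow_pow_eq_self_of_dvd hdk hα, pow_pow_eq_self_of_dvd hdn hα⟩
  have ht {α : AlgebraicClosure (ZMod p)} (hα : α ^ p ^ d = α) : u + α ≠ 0 := by
    intro h
    have h1 := (hfix hα).1
    rw [eq_neg_of_add_eq_zero_left h] at hv
    simp [h1] at hv
  have htv {α : AlgebraicClosure (ZMod p)} (hα : α ^ p ^ d = α) :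
      u + α - σ (u + α) = u - σ u := by
    rw [map_add, (hfix hα).1]
    ring
  have hbase : -1 / (1 + (u - u ^ q) ^ (q - 1)) = -((u - σ u) / (u - σ (σ u))) := by
    rw [hD, neg_div, one_div_div]
  have hparam {α : AlgebraicClosure (ZMod p)} (hα : α ^ p ^ d = α) :
      -(u + α) ^ (q ^ 2 - q) / (1 + (u - u ^ q) ^ (q - 1)) =
        -(σ (σ (u + α)) / σ (u + α) * ((u - σ u) / (u - σ (σ u)))) := by
    rw [hD, pow_sub₀ _ (ht hα) (Nat.le_self_pow two_ne_zero q), hσσ, hσ]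
    simp only [div_eq_mul_inv, mul_inv, inv_inv]
    ring
  have ha' : a = σ (σ (u - σ u)) * (u - σ u) / (σ (u - σ (σ u)) * (u - σ (σ u))) := by
    rw [ha, pow_succ _ (q ^ 2), pow_succ _ q, hσ u, hσσ, hσσ, hσ]
  have hτu : τ u = u := by rw [← hτ, huQ]
  refine ⟨?_, ?_, ?_⟩
  · rw [hD]
    exact div_ne_zero hw hv
  · ext x
    simp only [Set.mem_ofPred_eq, Set.mem_union, Set.mem_singleton_iff]
    rw [hbase, hτ, pow_succ, hσ, ha']
    constructor
    · rintro ⟨hxQ, hx⟩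
      refine or_iff_not_imp_left.2 fun hne => ?_
      have hα := twisted_root_translate σ hv hw hx hne
      set α := (u - σ u) * σ (u - σ u) /
        ((u - σ (σ u)) * (x + (u - σ u) / (u - σ (σ u)))) - σ u with hαdef
      have hα' : τ α = α := by
        simp only [hαdef, map_sub, map_mul, map_div₀, map_add, hcomm, hτu, hxQ]
      have hαd : α ^ p ^ d = α := by
        rw [hd]
        refine pow_pow_gcd_eq_self ?_ ?_
        · rw [← hQ, hτ, hα']
        · rw [← hq, hσ, hα]
      refine ⟨α, hαd, ?_⟩
      have hy : x + (u - σ u) / (u - σ (σ u)) ≠ 0 := fun h =>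
        hne (eq_neg_of_add_eq_zero_left h)
      have hσt : σ (u + α) = (u - σ u) * σ (u - σ u) /
          ((u - σ (σ u)) * (x + (u - σ u) / (u - σ (σ u)))) := by
        rw [map_add, hα, hαdef]
        ring
      rw [hparam hαd]
      refine add_right_cancel (b := (u - σ u) / (u - σ (σ u))) ?_
      rw [twisted_param_sub_base σ hw (ht hαd) (htv hαd), hσt]
      generalize x + (u - σ u) / (u - σ (σ u)) = y at hy
      generalize σ (u - σ u) = v' at hv'
      field_simp
    · rintro (rfl | ⟨α, hα, rfl⟩)
      · exact ⟨by simp only [map_neg, map_div₀, map_sub, hcomm, hτu], twisted_root_base σ hw⟩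
      · rw [hparam hα]
        exact ⟨by simp only [map_neg, map_div₀, map_mul, map_sub, map_add, hcomm, hτu,
          (hfix hα).2], twisted_root_param σ hw (ht hα) (htv hα)⟩
  · have himage : {x : AlgebraicClosure (ZMod p) | ∃ α : AlgebraicClosure (ZMod p), α ^ p ^ d = α ∧
        x = -(u + α) ^ (q ^ 2 - q) / (1 + (u - u ^ q) ^ (q - 1))} =
        (fun α => -(u + α) ^ (q ^ 2 - q) / (1 + (u - u ^ q) ^ (q - 1))) ''
          {α : AlgebraicClosure (ZMod p) | α ^ p ^ d = α} := by
      ext x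
      simp only [Set.mem_ofPred_eq, Set.mem_image, eq_comm]
    have hcard := ncard_pow_pow_eq_self (K := AlgebraicClosure (ZMod p)) (p := p) hd0
    have hfin : {α : AlgebraicClosure (ZMod p) | α ^ p ^ d = α}.Finite :=
      Set.finite_of_ncard_ne_zero (by rw [hcard]; exact (pow_pos hpp.pos d).ne')
    rw [himage, Set.singleton_union, Set.ncard_insert_of_notMem _ (hfin.image _),
      Set.InjOn.ncard_image, hcard]
    · intro α hα β hβ h
      simp only [hparam hα, hparam hβ] at h
      have h' := congrArg (· + (u - σ u) / (u - σ (σ u))) h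
      simp only [twisted_param_sub_base σ hw (ht hα) (htv hα),
        twisted_param_sub_base σ hw (ht hβ) (htv hβ)] at h'
      rw [div_eq_div_iff (mul_ne_zero hw ((map_ne_zero σ).2 (ht hα)))
        (mul_ne_zero hw ((map_ne_zero σ).2 (ht hβ))),
        mul_right_inj' (mul_ne_zero hv hv'), mul_right_inj' hw] at h'
      exact add_left_cancel (σ.injective h'.symm)
    · rintro ⟨α, hα, h⟩
      simp only [hparam hα, hbase] at h
      have h' := congrArg (· + (u - σ u) / (u - σ (σ u))) h
      simp only [twisted_param_sub_base σ hw (ht hα) (htv hα), neg_add_cancel] at h'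
      exact div_ne_zero (mul_ne_zero hv hv')
        (mul_ne_zero hw ((map_ne_zero σ).2 (ht hα))) h'
end
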